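/- (1) Given natural numbers m < n, every C^(n)-weakly shrewd cardinal is C^(m)-weakly shrewd. (2) A cardinal is weakly shrewd if and only if it is C^(n)-weakly shrewd for some natural number n < 2. -/

import Mathlib

namespace Paper

/-- First-order formulas in the language of set theory (one binary relation, membership),
using de Bruijn variables; `all` binds the last variable. -/
inductive SetFormula : ℕ → Type
  | mem {n : ℕ} (i j : Fin n) : SetFormula n
  | eq {n : ℕ} (i j : Fin n) : SetFormula n
  | fal {n : ℕ} : SetFormula n
  | imp {n : ℕ} (φ ψ : SetFormula n) : SetFormula n
  | all {n : ℕ} (φ : SetFormula (n + 1)) : SetFormula n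

namespace SetFormula

/-- Negation. -/
def not {n : ℕ} (φ : SetFormula n) : SetFormula n := φ.imp .fal

/-- Conjunction. -/
def and {n : ℕ} (φ ψ : SetFormula n) : SetFormula n := (φ.imp ψ.not).not

/-- Existential quantification (over the last variable). -/
def ex {n : ℕ} (φ : SetFormula (n + 1)) : SetFormula n := (SetFormula.all φ.not).not

end SetFormula

/-- Satisfaction of a set-theoretic formula in a structure `(M, E)`, where `E` interprets
the membership relation. -/
def Realize {M : Type*} (E : M → M → Prop) : ∀ {n : ℕ}, SetFormula n → (Fin n → M) → Prop
  | _, .mem i j, v => E (v i) (v j)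
  | _, .eq i j, v => v i = v j
  | _, .fal, _ => False
  | _, .imp φ ψ, v => Realize E φ v → Realize E ψ v
  | _, .all φ, v => ∀ a, Realize E φ (Fin.snoc v a)

/-- Satisfaction of a formula relativized to the subclass `S` of `M`; all quantifiers
range over `S`, and the assignment is required to take values in `S`. -/
def RealizeIn {M : Type*} (E : M → M → Prop) (S : M → Prop) {n : ℕ}
    (φ : SetFormula n) (v : Fin n → M) : Prop :=
  ∃ h : ∀ i, S (v i),
    Realize (fun a b : {x : M // S x} => E a.1 b.1) φ fun i => ⟨v i, h i⟩

/-- `Δ₀`-formulas: formulas all of whose quantifiers are bounded. -/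
inductive IsDelta0 : ∀ {n : ℕ}, SetFormula n → Prop
  | mem {n : ℕ} (i j : Fin n) : IsDelta0 (.mem i j)
  | eq {n : ℕ} (i j : Fin n) : IsDelta0 (.eq i j)
  | fal {n : ℕ} : IsDelta0 (n := n) .fal
  | imp {n : ℕ} {φ ψ : SetFormula n} : IsDelta0 φ → IsDelta0 ψ → IsDelta0 (φ.imp ψ)
  | ball {n : ℕ} (j : Fin n) {φ : SetFormula (n + 1)} :
      IsDelta0 φ → IsDelta0 (.all ((SetFormula.mem (Fin.last n) j.castSucc).imp φ))
  | bex {n : ℕ} (j : Fin n) {φ : SetFormula (n + 1)} :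
      IsDelta0 φ → IsDelta0 (SetFormula.ex ((SetFormula.mem (Fin.last n) j.castSucc).and φ))

mutual
  /-- `Σₙ`-formulas of the Lévy hierarchy. -/
  inductive IsSigma : ℕ → ∀ {n : ℕ}, SetFormula n → Prop
    | ofDelta0 {k n : ℕ} {φ : SetFormula n} : IsDelta0 φ → IsSigma k φ
    | ofPi {k n : ℕ} {φ : SetFormula n} : IsPi k φ → IsSigma (k + 1) φ
    | ex {k n : ℕ} {φ : SetFormula (n + 1)} : IsSigma (k + 1) φ → IsSigma (k + 1) φ.ex
  /-- `Πₙ`-formulas of the Lévy hierarchy. -/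
  inductive IsPi : ℕ → ∀ {n : ℕ}, SetFormula n → Prop
    | ofDelta0 {k n : ℕ} {φ : SetFormula n} : IsDelta0 φ → IsPi k φ
    | ofSigma {k n : ℕ} {φ : SetFormula n} : IsSigma k φ → IsPi (k + 1) φ
    | all {k n : ℕ} {φ : SetFormula (n + 1)} : IsPi (k + 1) φ → IsPi (k + 1) φ.all
end

end Paper
namespace Paper

section Generic

variable {M : Type*} (E : M → M → Prop)

/-- `x` is a transitive set (relative to the membership relation `E`). -/
def TransE (x : M) : Prop := ∀ y, E y x → ∀ z, E z y → E z x

/-- `x` is an ordinal: a transitive set all of whose elements are transitive. -/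
def OrdE (x : M) : Prop := TransE E x ∧ ∀ y, E y x → TransE E y

/-- `a ⊆ b`. -/
def SubE (a b : M) : Prop := ∀ z, E z a → E z b

/-- `a ≤ b` for ordinals. -/
def LeE (a b : M) : Prop := E a b ∨ a = b

/-- `x` is the empty set. -/
def EmptyE (x : M) : Prop := ∀ z, ¬ E z x

/-- `s = y ∪ {y}`. -/
def SuccSpecE (s y : M) : Prop := ∀ z, E z s ↔ (E z y ∨ z = y)

/-- `l` is a (nonzero) limit ordinal. -/
def LimitE (l : M) : Prop := OrdE E l ∧ (∃ w, E w l) ∧ ∀ α, E α l → ∃ β, E β l ∧ E α β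

/-- `w` is the first infinite ordinal `ω`. -/
def OmegaSpecE (w : M) : Prop := LimitE E w ∧ ∀ x, E x w → ¬ LimitE E x

/-- `x` is an infinite ordinal, i.e. an ordinal with `ω ≤ x`. -/
def InfiniteOrdE (x : M) : Prop := OrdE E x ∧ ∃ w, OmegaSpecE E w ∧ LeE E w x

/-- `p = {a, b}`. -/
def UPairE (p a b : M) : Prop := ∀ z, E z p ↔ (z = a ∨ z = b)

/-- `p` is the Kuratowski ordered pair `⟨a, b⟩`. -/
def OPairE (p a b : M) : Prop :=
  ∃ s t, UPairE E s a a ∧ UPairE E t a b ∧ UPairE E p s t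

/-- The ordered pair `⟨x, y⟩` is an element of `f`. -/
def PairMemE (f x y : M) : Prop := ∃ p, E p f ∧ OPairE E p x y

/-- `f` is (the graph of) a function from `a` to `b`. -/
def IsFuncE (f a b : M) : Prop :=
  (∀ p, E p f → ∃ x y, E x a ∧ E y b ∧ OPairE E p x y) ∧
    ∀ x, E x a → (∃ y, PairMemE E f x y) ∧
      ∀ y y', PairMemE E f x y → PairMemE E f x y' → y = y'

/-- `f` is a surjection from `a` onto `b`. -/
def SurjE (f a b : M) : Prop :=
  IsFuncE E f a b ∧ ∀ y, E y b → ∃ x, E x a ∧ PairMemE E f x y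

/-- `f` is an injection from `a` into `b`. -/
def InjE (f a b : M) : Prop :=
  IsFuncE E f a b ∧ ∀ x x' y, E x a → E x' a →
    PairMemE E f x y → PairMemE E f x' y → x = x'

/-- `f` is a bijection between `a` and `b`. -/
def BijE (f a b : M) : Prop := SurjE E f a b ∧ InjE E f a b

/-- `κ` is a cardinal: an ordinal not in bijection with any of its elements. -/
def CardE (κ : M) : Prop := OrdE E κ ∧ ∀ α, E α κ → ¬ ∃ f, BijE E f α κ

/-- `κ` is an infinite cardinal. -/
def InfCardE (κ : M) : Prop := CardE E κ ∧ InfiniteOrdE E κ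

/-- `b = a ∩ c`. -/
def InterSpecE (b a c : M) : Prop := ∀ z, E z b ↔ (E z a ∧ E z c)

/-- `c` is unbounded in the ordinal `κ`. -/
def UnboundedInE (c κ : M) : Prop := ∀ α, E α κ → ∃ β, E β c ∧ E α β

/-- `c` is closed in the ordinal `κ`: it contains each of its limit points below `κ`. -/
def ClosedInE (c κ : M) : Prop :=
  ∀ l, E l κ → (∃ w, E w l) → (∀ α, E α l → ∃ β, E β c ∧ E α β ∧ E β l) → E l c

/-- `c` is a closed unbounded subset of the ordinal `κ`. -/
def ClubInE (c κ : M) : Prop := SubE E c κ ∧ UnboundedInE E c κ ∧ ClosedInE E c κ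

/-- `f` is (the graph of) a sequence `⟨A_α | α < κ⟩` with `A_α ⊆ α` for all `α < κ`. -/
def SeqSpecE (f κ : M) : Prop :=
  ∀ α, E α κ → (∃ A, PairMemE E f α A ∧ SubE E A α) ∧
    ∀ A A', PairMemE E f α A → PairMemE E f α A' → A = A'

/-- `κ` is a subtle cardinal. -/
def SubtleE (κ : M) : Prop :=
  InfCardE E κ ∧ ∀ f, SeqSpecE E f κ → ∀ c, ClubInE E c κ →
    ∃ α β, E α c ∧ E β c ∧ E α β ∧
      ∃ A B, PairMemE E f α A ∧ PairMemE E f β B ∧ InterSpecE E A B α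

/-- `κ` is a regular ordinal: every function from an element of `κ` to `κ` has
bounded range. -/
def RegularE (κ : M) : Prop :=
  OrdE E κ ∧ ∀ γ f, E γ κ → IsFuncE E f γ κ →
    ∃ β, E β κ ∧ ∀ x y, PairMemE E f x y → E y β

/-- `p = 𝒫(a)`. -/
def PowSpecE (p a : M) : Prop := ∀ z, E z p ↔ SubE E z a

/-- `κ` is a strong limit cardinal: for every `α < κ`, `2^|α| < κ`. -/
def StrongLimitE (κ : M) : Prop :=
  ∀ α, E α κ → ∀ p, PowSpecE E p α → ∃ β f, E β κ ∧ InjE E f p β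

/-- `κ` is a strongly inaccessible cardinal: an uncountable regular strong limit
cardinal. -/
def InaccE (κ : M) : Prop :=
  CardE E κ ∧ (∃ w, OmegaSpecE E w ∧ E w κ) ∧ RegularE E κ ∧ StrongLimitE E κ

/-- `z` belongs to the transitive closure of `x`. -/
def TCMemE (z x : M) : Prop := ∀ t, TransE E t → SubE E x t → E z t

/-- `x ∈ H(θ)`: the transitive closure of `x` has cardinality less than `θ`. -/
def HMemE (x θ : M) : Prop :=
  ∃ t, TransE E t ∧ SubE E x t ∧ ∃ β f, E β θ ∧ SurjE E f β t

/-- `f` is (the graph of) the cumulative-hierarchy sequence `⟨V_β | β < α⟩`,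
determined by the recursion `V_β = {z | ∃ γ < β, z ⊆ V_γ}`. -/
def VHierE (f α : M) : Prop :=
  OrdE E α ∧ ∀ β, E β α →
    (∃ w, PairMemE E f β w ∧
      ∀ z, E z w ↔ ∃ γ, E γ β ∧ ∃ u, PairMemE E f γ u ∧ SubE E z u) ∧
    ∀ w w', PairMemE E f β w → PairMemE E f β w' → w = w'

/-- `x ∈ V_α`. -/
def VMemE (x α : M) : Prop :=
  OrdE E α ∧ ∃ f, VHierE E f α ∧ ∃ β u, E β α ∧ PairMemE E f β u ∧ SubE E x u

/-- The class `S` is a `Σₙ`-elementary subclass of the class `T`. -/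
def SigmaElemPairE (n : ℕ) (S T : M → Prop) : Prop :=
  (∀ x, S x → T x) ∧
    ∀ ⦃k : ℕ⦄ (φ : SetFormula k), IsSigma n φ → ∀ v : Fin k → M, (∀ i, S (v i)) →
      (RealizeIn E S φ v ↔ RealizeIn E T φ v)

/-- The class `S` is a (fully) elementary subclass of the class `T`. -/
def ElemPairE (S T : M → Prop) : Prop :=
  (∀ x, S x → T x) ∧
    ∀ ⦃k : ℕ⦄ (φ : SetFormula k) (v : Fin k → M), (∀ i, S (v i)) →
      (RealizeIn E S φ v ↔ RealizeIn E T φ v)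

/-- `j` is an elementary map from the class `S` into the class `T`. -/
def ElemMapE (S T : M → Prop) (j : M → M) : Prop :=
  (∀ x, S x → T (j x)) ∧
    ∀ ⦃k : ℕ⦄ (φ : SetFormula k) (v : Fin k → M), (∀ i, S (v i)) →
      (RealizeIn E S φ v ↔ RealizeIn E T φ fun i => j (v i))

/-- `α ∈ C⁽ⁿ⁾`: the ordinal `α` is `Σₙ`-correct, i.e. `V_α` is a `Σₙ`-elementary
submodel of the universe. -/
def CnE (n : ℕ) (α : M) : Prop :=
  OrdE E α ∧ SigmaElemPairE E n (fun x => VMemE E x α) fun _ => True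

/-- `κ` is a weakly shrewd cardinal. -/
def WeaklyShrewdE (κ : M) : Prop :=
  CardE E κ ∧ ∀ (φ : SetFormula 2) (θ z : M), CardE E θ → E κ θ → SubE E z κ →
    RealizeIn E (fun x => HMemE E x θ) φ ![z, κ] →
    ∃ κ' θ' z', CardE E κ' ∧ CardE E θ' ∧ E κ' θ' ∧ E κ' κ ∧
      InterSpecE E z' z κ' ∧ RealizeIn E (fun x => HMemE E x θ') φ ![z', κ']

/-- `κ` is a `C⁽ⁿ⁾`-weakly shrewd cardinal. -/
def CnWeaklyShrewdE (n : ℕ) (κ : M) : Prop :=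
  CardE E κ ∧ ∀ (φ : SetFormula 2) (θ z : M), CardE E θ → CnE E n θ → E κ θ →
    SubE E z κ → RealizeIn E (fun x => HMemE E x θ) φ ![z, κ] →
    ∃ κ' θ' z', CardE E κ' ∧ CardE E θ' ∧ CnE E n θ' ∧ E κ' θ' ∧ E κ' κ ∧
      InterSpecE E z' z κ' ∧ RealizeIn E (fun x => HMemE E x θ') φ ![z', κ']

/-- Axiom of extensionality for `(M, E)`. -/
def AxExtE : Prop := ∀ x y : M, (∀ z, E z x ↔ E z y) → x = y

/-- Axiom of pairing for `(M, E)`. -/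
def AxPairE : Prop := ∀ a b : M, ∃ p, UPairE E p a b

/-- Axiom of union for `(M, E)`. -/
def AxUnionE : Prop := ∀ a : M, ∃ u, ∀ z, E z u ↔ ∃ y, E y a ∧ E z y

/-- Axiom of power set for `(M, E)`. -/
def AxPowE : Prop := ∀ a : M, ∃ p, PowSpecE E p a

/-- Axiom of infinity for `(M, E)`. -/
def AxInfE : Prop :=
  ∃ I : M, (∃ e, E e I ∧ EmptyE E e) ∧ ∀ y, E y I → ∃ s, E s I ∧ SuccSpecE E s y

/-- Axiom of foundation for `(M, E)`. -/
def AxFoundE : Prop :=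
  ∀ a : M, (∃ z, E z a) → ∃ m, E m a ∧ ∀ z, E z a → ¬ E z m

/-- Separation scheme for `(M, E)`. -/
def AxSepE : Prop :=
  ∀ (k : ℕ) (φ : SetFormula (k + 1)) (p : Fin k → M) (a : M),
    ∃ s : M, ∀ z, E z s ↔ (E z a ∧ Realize E φ (Fin.cons z p))

/-- Replacement scheme for `(M, E)`. -/
def AxReplE : Prop :=
  ∀ (k : ℕ) (φ : SetFormula (k + 2)) (p : Fin k → M) (a : M),
    (∀ x, E x a → ∀ y y', Realize E φ (Fin.cons x (Fin.cons y p)) →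
      Realize E φ (Fin.cons x (Fin.cons y' p)) → y = y') →
    ∃ b : M, ∀ y, E y b ↔ ∃ x, E x a ∧ Realize E φ (Fin.cons x (Fin.cons y p))

/-- Axiom of choice for `(M, E)`. -/
def AxChoiceE : Prop :=
  ∀ a : M, (∀ x, E x a → ∃ z, E z x) →
    (∀ x y, E x a → E y a → x ≠ y → ¬ ∃ z, E z x ∧ E z y) →
    ∃ c, ∀ x, E x a → ∃ z, E z c ∧ E z x ∧ ∀ z', E z' c → E z' x → z' = z

/-- `(M, E)` is a model of `ZF⁻` (Zermelo–Fraenkel set theory without the power set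
axiom). -/
def IsZFMinusE : Prop :=
  AxExtE E ∧ AxPairE E ∧ AxUnionE E ∧ AxInfE E ∧ AxFoundE E ∧ AxSepE E ∧ AxReplE E

/-- `(M, E)` is a model of `ZFC`. -/
def IsZFCE : Prop :=
  Nonempty M ∧ IsZFMinusE E ∧ AxPowE E ∧ AxChoiceE E

/-- The set `m` is, with the induced membership relation, a transitive model
of `ZF⁻`. -/
def ZFMinusModelE (m : M) : Prop :=
  IsZFMinusE fun a b : {x : M // E x m} => E a.1 b.1

/-- `x` has cardinality `κ`. -/
def CardEqE (x κ : M) : Prop := ∃ f, BijE E f κ x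

/-- `m` is closed under sequences of length less than `κ`: `^{<κ}m ⊆ m`. -/
def SmallSeqClosedE (m κ : M) : Prop := ∀ γ f, E γ κ → IsFuncE E f γ m → E f m

/-- `κ` is a `C⁽ⁿ⁾`-strongly unfoldable cardinal. -/
def CnStronglyUnfoldableE (n : ℕ) (κ : M) : Prop :=
  InaccE E κ ∧ ∀ lam, CnE E n lam → E κ lam →
    ∀ m, TransE E m → ZFMinusModelE E m → CardEqE E m κ → E κ m →
      SmallSeqClosedE E m κ →
      ∃ N j κ', TransE E N ∧ (∀ x, VMemE E x lam → E x N) ∧ IsFuncE E j m N ∧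
        (∀ ⦃k : ℕ⦄ (φ : SetFormula k) (v w : Fin k → M), (∀ i, E (v i) m) →
          (∀ i, PairMemE E j (v i) (w i)) →
          (RealizeIn E (fun x => E x m) φ v ↔ RealizeIn E (fun x => E x N) φ w)) ∧
        (∀ α, E α κ → PairMemE E j α α) ∧ PairMemE E j κ κ' ∧ E lam κ' ∧
        SigmaElemPairE E n (fun x => VMemE E x lam) fun x => E x N ∧ VMemE E x κ'

/-- `x` is ordinal definable. -/
def IsODE (x : M) : Prop :=
  ∃ (k : ℕ) (φ : SetFormula (k + 1)) (p : Fin k → M), (∀ i, OrdE E (p i)) ∧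
    Realize E φ (Fin.cons x p) ∧ ∀ y, Realize E φ (Fin.cons y p) → y = x

/-- `x` is hereditarily ordinal definable, i.e. `x ∈ HOD`. -/
def IsHODE (x : M) : Prop := IsODE E x ∧ ∀ z, TCMemE E z x → IsODE E z

/-- The instance of the principle "`Ord` is essentially faint" for the class
sequence `⟨{A | Efam α A} | α ∈ Ord⟩`. -/
def FaintForE (Efam : M → M → Prop) : Prop :=
  (∀ α, OrdE E α → (∃ A, Efam α A) ∧ ∀ A, Efam α A → SubE E A α) →
    ∀ ξ, OrdE E ξ → ∃ α β A B, OrdE E α ∧ OrdE E β ∧ E ξ α ∧ E α β ∧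
      Efam β A ∧ InterSpecE E B A α ∧ Efam α B

/-- `C` is a closed unbounded class of ordinals. -/
def ClubClassE (C : M → Prop) : Prop :=
  (∀ x, C x → OrdE E x) ∧ (∀ α, OrdE E α → ∃ β, C β ∧ E α β) ∧
    ∀ l, OrdE E l → (∃ w, E w l) → (∀ α, E α l → ∃ β, C β ∧ E α β ∧ E β l) → C l

/-- The instance of the principle "`Ord` is essentially subtle" for the class
sequence `⟨{A | Efam α A} | α ∈ Ord⟩` and the class `C`. -/
def SubtleForE (Efam : M → M → Prop) (C : M → Prop) : Prop :=
  (∀ α, OrdE E α → (∃ A, Efam α A) ∧ ∀ A, Efam α A → SubE E A α) →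
    ClubClassE E C →
    ∃ α β A B, C α ∧ C β ∧ E α β ∧ Efam β A ∧ InterSpecE E B A α ∧ Efam α B

/-- The scheme "`Ord` is essentially faint" holds in `(M, E)`: every instance for a
definable (with parameters) class sequence holds. -/
def OrdFaintDefE : Prop :=
  ∀ (k : ℕ) (φ : SetFormula (k + 2)) (p : Fin k → M),
    FaintForE E fun α A => Realize E φ (Fin.cons α (Fin.cons A p))

/-- The scheme "`Ord` is essentially subtle" holds in `(M, E)`: every instance for
definable (with parameters) class sequences and club classes holds. -/
def OrdSubtleDefE : Prop :=
  ∀ (k k' : ℕ) (φ : SetFormula (k + 2)) (p : Fin k → M)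
    (ψ : SetFormula (k' + 1)) (q : Fin k' → M),
    SubtleForE E (fun α A => Realize E φ (Fin.cons α (Fin.cons A p)))
      fun x => Realize E ψ (Fin.cons x q)

/-- There is a proper class of subtle cardinals in `(M, E)`. -/
def ProperClassSubtleE : Prop := ∀ α, OrdE E α → ∃ κ, SubtleE E κ ∧ E α κ

/-- There are no strongly inaccessible cardinals in `(M, E)`. -/
def NoInaccE : Prop := ∀ κ, ¬ InaccE E κ

end Generic

end Paper
namespace Paper

/-- The membership relation on the universe `ZFSet` of sets. -/
def zmem : ZFSet.{0} → ZFSet.{0} → Prop := fun x y => x ∈ y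

/-- The membership relation on the inner model `HOD` of all hereditarily ordinal
definable sets. -/
def hodMem : {x : ZFSet.{0} // IsHODE zmem x} → {x : ZFSet.{0} // IsHODE zmem x} → Prop :=
  fun a b => a.1 ∈ b.1

/-- `κ` is a subtle cardinal in the inner model `HOD`. -/
def IsSubtleInHOD (κ : ZFSet.{0}) : Prop :=
  ∃ h : IsHODE zmem κ, SubtleE hodMem ⟨κ, h⟩

end Paper

namespace Paper


end Paper

namespace Paper

abbrev Z := ZFSet.{0}

/-- Satisfaction relative to a class, with plain assignments. -/
def RI (S : Z → Prop) : ∀ {n : ℕ}, SetFormula n → (Fin n → Z) → Prop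
  | _, .mem i j, v => v i ∈ v j
  | _, .eq i j, v => v i = v j
  | _, .fal, _ => False
  | _, .imp φ ψ, v => RI S φ v → RI S ψ v
  | _, .all φ, v => ∀ a, S a → RI S φ (Fin.snoc v a)

lemma snoc_mem {S : Z → Prop} {n : ℕ} {v : Fin n → Z} (h : ∀ i, S (v i)) {a : Z} (ha : S a) :
    ∀ i, S (Fin.snoc (α := fun _ => Z) v a i) := by
  intro i
  refine Fin.lastCases ?_ (fun i => ?_) i
  · simpa using ha
  · simpa using h i

lemma realize_iff_RI (S : Z → Prop) {n : ℕ} (φ : SetFormula n) (v : Fin n → Z)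
    (h : ∀ i, S (v i)) :
    Realize (fun a b : {x : Z // S x} => zmem a.1 b.1) φ (fun i => ⟨v i, h i⟩) ↔ RI S φ v := by
  induction φ with
  | mem i j => exact Iff.rfl
  | eq i j => simp [Realize, RI]
  | fal => exact Iff.rfl
  | imp φ ψ ih1 ih2 => simp only [Realize, RI, ih1, ih2]
  | all φ ih =>
    simp only [Realize, RI, Subtype.forall]
    refine forall_congr' fun a => forall_congr' fun ha => ?_
    rw [← ih (Fin.snoc v a) (snoc_mem h ha)]
    have : (Fin.snoc (α := fun _ => {x : Z // S x}) (fun i => ⟨v i, h i⟩) ⟨a, ha⟩)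
        = fun i => ⟨Fin.snoc (α := fun _ => Z) v a i, snoc_mem h ha i⟩ := by
      funext i
      refine Fin.lastCases ?_ (fun i => ?_) i <;> simp
    rw [this]

lemma realizeIn_iff {S : Z → Prop} {n : ℕ} {φ : SetFormula n} {v : Fin n → Z} :
    RealizeIn zmem S φ v ↔ (∀ i, S (v i)) ∧ RI S φ v := by
  constructor
  · rintro ⟨h, h2⟩
    exact ⟨h, (realize_iff_RI S φ v h).1 h2⟩
  · rintro ⟨h, h2⟩
    exact ⟨h, (realize_iff_RI S φ v h).2 h2⟩

lemma RI_not {S : Z → Prop} {n : ℕ} {φ : SetFormula n} {v : Fin n → Z} :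
    RI S φ.not v ↔ ¬ RI S φ v := Iff.rfl

lemma RI_and {S : Z → Prop} {n : ℕ} {φ ψ : SetFormula n} {v : Fin n → Z} :
    RI S (φ.and ψ) v ↔ RI S φ v ∧ RI S ψ v := by
  simp only [SetFormula.and, RI_not, RI]; tauto

lemma RI_ex {S : Z → Prop} {n : ℕ} {φ : SetFormula (n+1)} {v : Fin n → Z} :
    RI S φ.ex v ↔ ∃ a, S a ∧ RI S φ (Fin.snoc v a) := by
  simp only [SetFormula.ex, RI_not, RI]; push Not; rfl

/-- Transitive classes. -/
def TC (D : Z → Prop) : Prop := ∀ x, D x → ∀ y ∈ x, D y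

/-- Semantic version of the Lévy hierarchy, with named variables. -/
inductive Fam (N : Type 1) [DecidableEq N] :
    ℕ → ((Z → Prop) → (N → Z) → Prop) → Prop
  | mem (i j : N) : Fam N 0 (fun _ s => s i ∈ s j)
  | eq (i j : N) : Fam N 0 (fun _ s => s i = s j)
  | fal : Fam N 0 (fun _ _ => False)
  | imp {ρ σ} : Fam N 0 ρ → Fam N 0 σ → Fam N 0 (fun D s => ρ D s → σ D s)
  | ball {ρ} (i j : N) (hij : i ≠ j) : Fam N 0 ρ →
      Fam N 0 (fun D s => ∀ a, a ∈ s j → ρ D (Function.update s i a))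
  | neg {k ρ} : Fam N k ρ → Fam N (k+1) (fun D s => ¬ ρ D s)
  | ex {k ρ} (i : N) : Fam N (k+1) ρ →
      Fam N (k+1) (fun D s => ∃ a, D a ∧ ρ D (Function.update s i a))

section
variable {N : Type 1} [DecidableEq N]

lemma Fam.of_zero (k : ℕ) : ∀ {ρ}, Fam N 0 ρ → Fam N k ρ := by
  induction k with
  | zero => exact fun h => h
  | succ k ih =>
    intro ρ h
    have := Fam.neg (ih (Fam.imp h Fam.fal))
    convert this using 3
    simp

lemma update_names {n : ℕ} (c : ℕ → N) (hc : Function.Injective c) (s : N → Z) (a : Z) :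
    (fun i : Fin (n+1) => Function.update s (c n) a (c i)) =
      Fin.snoc (α := fun _ => Z) (fun i : Fin n => s (c i)) a := by
  funext i
  refine Fin.lastCases ?_ (fun i => ?_) i
  · simp
  · have : c (i : ℕ) ≠ c n := fun h => by have := hc h; have := i.2; omega
    simp [Function.update_of_ne this]

lemma upd_D {D : Z → Prop} {n : ℕ} (c : ℕ → N) (hc : Function.Injective c) (s : N → Z) {a : Z}
    (hs : ∀ i : Fin n, D (s (c i))) (ha : D a) :
    ∀ i : Fin (n+1), D (Function.update s (c n) a (c i)) := by
  intro i
  have := congrFun (update_names (n := n) c hc s a) i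
  rw [this]
  exact snoc_mem hs ha i

lemma delta0_fam (c : ℕ → N) (hc : Function.Injective c) {n : ℕ} {φ : SetFormula n}
    (h : IsDelta0 φ) : ∃ ρ, Fam N 0 ρ ∧ ∀ D, TC D → ∀ s : N → Z, (∀ i : Fin n, D (s (c i))) →
      (RI D φ (fun i => s (c i)) ↔ ρ D s) := by
  induction h with
  | mem i j => exact ⟨_, Fam.mem (c i) (c j), fun D _ s _ => Iff.rfl⟩
  | eq i j => exact ⟨_, Fam.eq (c i) (c j), fun D _ s _ => Iff.rfl⟩
  | fal => exact ⟨_, Fam.fal, fun D _ s _ => Iff.rfl⟩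
  | imp _ _ ih1 ih2 =>
    obtain ⟨ρ, h1, h1'⟩ := ih1
    obtain ⟨σ, h2, h2'⟩ := ih2
    exact ⟨_, Fam.imp h1 h2, fun D hD s hs => by simp only [RI, h1' D hD s hs, h2' D hD s hs]⟩
  | @ball n j φ _ ih =>
    obtain ⟨ρ, h1, h1'⟩ := ih
    refine ⟨_, Fam.ball (c n) (c j) (fun h => ?_) h1, fun D hD s hs => ?_⟩
    · have := hc h; have := j.2; omega
    · simp only [RI, Fin.snoc_last, Fin.snoc_castSucc]
      constructor
      · intro h a ha
        have hDa := hD _ (hs j) a ha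
        rw [← h1' D hD _ (upd_D c hc s hs hDa), update_names c hc]
        exact h a hDa ha
      · intro h a hDa ha
        have := h a ha
        rwa [← h1' D hD _ (upd_D c hc s hs hDa), update_names c hc] at this
  | @bex n j φ _ ih =>
    obtain ⟨ρ, h1, h1'⟩ := ih
    refine ⟨_, Fam.imp (Fam.ball (c n) (c j) (fun h => ?_) (Fam.imp h1 Fam.fal)) Fam.fal,
      fun D hD s hs => ?_⟩
    · have := hc h; have := j.2; omega
    · simp only [RI_ex, RI_and, RI, Fin.snoc_last, Fin.snoc_castSucc]
      constructor
      · rintro ⟨a, hDa, ha, h⟩ h2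
        refine h2 a ha ?_
        rwa [← h1' D hD _ (upd_D c hc s hs hDa), update_names c hc]
      · intro h
        by_contra h2
        apply h
        intro a ha h3
        have hDa := hD _ (hs j) a ha
        rw [← h1' D hD _ (upd_D c hc s hs hDa), update_names c hc] at h3
        exact h2 ⟨a, hDa, ha, h3⟩

/-- the property: `φ` is captured by a member of the family. -/
def Cap (c : ℕ → N) (k : ℕ) {n : ℕ} (P : (Z → Prop) → (Fin n → Z) → Prop) : Prop :=
  ∃ ρ, Fam N k ρ ∧ ∀ D, TC D → ∀ s : N → Z, (∀ i : Fin n, D (s (c i))) →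
      (P D (fun i => s (c i)) ↔ ρ D s)

lemma Cap.neg {c : ℕ → N} {k n : ℕ} {P : (Z → Prop) → (Fin n → Z) → Prop} (h : Cap c k P) :
    Cap c (k+1) (fun D v => ¬ P D v) := by
  obtain ⟨ρ, h, h'⟩ := h
  exact ⟨_, Fam.neg h, fun D hD s hs => not_congr (h' D hD s hs)⟩

lemma Cap.ex {c : ℕ → N} (hc : Function.Injective c) {k n : ℕ}
    {P : (Z → Prop) → (Fin (n+1) → Z) → Prop} (h : Cap c (k+1) P) :
    Cap c (k+1) (fun D v => ∃ a, D a ∧ P D (Fin.snoc v a)) := by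
  obtain ⟨ρ, h, h'⟩ := h
  refine ⟨_, Fam.ex (c n) h, fun D hD s hs => ?_⟩
  refine exists_congr fun a => and_congr_right fun ha => ?_
  rw [← h' D hD _ (upd_D c hc s hs ha), update_names c hc]

lemma sigma_cap (c : ℕ → N) (hc : Function.Injective c) {k n : ℕ} {φ : SetFormula n}
    (h : IsSigma k φ) : Cap c k (fun D v => RI D φ v) := by
  refine @IsSigma.rec (fun k n φ _ => Cap c k (fun D v => RI D φ v))
    (fun k n φ _ => Cap c k (fun D v => ¬ RI D φ v)) ?_ ?_ ?_ ?_ ?_ ?_ k n φ h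
  · intro k n φ h
    obtain ⟨ρ, h, h'⟩ := delta0_fam c hc h
    exact ⟨ρ, h.of_zero k, h'⟩
  · intro k n φ _ ih
    simpa only [not_not] using ih.neg
  · intro k n φ _ ih
    simpa only [RI_ex] using ih.ex hc
  · intro k n φ h
    obtain ⟨ρ, h, h'⟩ := delta0_fam c hc h
    exact ⟨_, (Fam.imp h Fam.fal).of_zero k, fun D hD s hs => not_congr (h' D hD s hs)⟩
  · intro k n φ _ ih
    exact ih.neg
  · intro k n φ _ ih
    simpa only [RI, not_forall, exists_prop] using ih.ex hc

lemma fam_sigma {k : ℕ} {ρ} (h : Fam N k ρ) : ∀ {n : ℕ} (f : N → Fin n),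
    (k = 0 → ∃ φ : SetFormula n, IsDelta0 φ ∧ ∀ D, TC D → ∀ v, (∀ i, D (v i)) →
      (RI D φ v ↔ ρ D (fun i => v (f i)))) ∧
    (∃ φ : SetFormula n, IsSigma k φ ∧ ∀ D, TC D → ∀ v, (∀ i, D (v i)) →
      (RI D φ v ↔ ρ D (fun i => v (f i)))) ∧
    (∃ φ : SetFormula n, IsPi k φ ∧ ∀ D, TC D → ∀ v, (∀ i, D (v i)) →
      (RI D φ v ↔ ¬ ρ D (fun i => v (f i)))) := by
  have key : ∀ {n : ℕ} (f : N → Fin n) (i : N) (v : Fin n → Z) (a : Z),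
      (fun l => Fin.snoc (α := fun _ => Z) v a
        (Function.update (fun l => (f l).castSucc) i (Fin.last n) l)) =
      Function.update (fun l => v (f l)) i a := by
    intro n f i v a
    funext l
    by_cases h : l = i
    · subst h; simp
    · simp [Function.update_of_ne h]
  have aux : ∀ {n : ℕ} (f : N → Fin n) (ρ : (Z → Prop) → (N → Z) → Prop),
      (∃ φ : SetFormula n, IsDelta0 φ ∧ ∀ D, TC D → ∀ v, (∀ i, D (v i)) →
      (RI D φ v ↔ ρ D (fun i => v (f i)))) →
      (0 = 0 → ∃ φ : SetFormula n, IsDelta0 φ ∧ ∀ D, TC D → ∀ v, (∀ i, D (v i)) →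
      (RI D φ v ↔ ρ D (fun i => v (f i)))) ∧
    (∃ φ : SetFormula n, IsSigma 0 φ ∧ ∀ D, TC D → ∀ v, (∀ i, D (v i)) →
      (RI D φ v ↔ ρ D (fun i => v (f i)))) ∧
    (∃ φ : SetFormula n, IsPi 0 φ ∧ ∀ D, TC D → ∀ v, (∀ i, D (v i)) →
      (RI D φ v ↔ ¬ ρ D (fun i => v (f i)))) := by
    rintro n f ρ ⟨φ, h, h'⟩
    refine ⟨fun _ => ⟨φ, h, h'⟩, ⟨φ, .ofDelta0 h, h'⟩, ⟨φ.imp .fal, .ofDelta0 (.imp h .fal), ?_⟩⟩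
    intro D hD v hv
    rw [← h' D hD v hv]; rfl
  induction h with
  | mem i j => exact fun f => aux f (fun _ s => s i ∈ s j) ⟨_, .mem (f i) (f j), fun _ _ _ _ => Iff.rfl⟩
  | eq i j => exact fun f => aux f (fun _ s => s i = s j) ⟨_, .eq (f i) (f j), fun _ _ _ _ => Iff.rfl⟩
  | fal => exact fun f => aux f (fun _ _ => False) ⟨_, .fal, fun _ _ _ _ => Iff.rfl⟩
  | @imp ρ σ _ _ ih1 ih2 =>
    intro n f
    obtain ⟨φ, h1, h1'⟩ := (ih1 f).1 rfl
    obtain ⟨ψ, h2, h2'⟩ := (ih2 f).1 rfl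
    exact aux f (fun D s => ρ D s → σ D s) ⟨_, .imp h1 h2, fun D hD v hv => by simp only [RI, h1' D hD v hv, h2' D hD v hv]⟩
  | @ball ρ i j hij _ ih =>
    intro n f
    obtain ⟨φ, h1, h1'⟩ := (ih (Function.update (fun l => (f l).castSucc) i (Fin.last n))).1 rfl
    refine aux f (fun D s => ∀ a, a ∈ s j → ρ D (Function.update s i a)) ⟨_, .ball (f j) h1, fun D hD v hv => ?_⟩
    simp only [RI, Fin.snoc_last, Fin.snoc_castSucc]
    constructor
    · intro h a ha
      have hDa := hD _ (hv _) a ha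
      have := h a hDa ha
      rwa [h1' D hD _ (snoc_mem hv hDa), key] at this
    · intro h a hDa ha
      rw [h1' D hD _ (snoc_mem hv hDa), key]
      exact h a ha
  | neg _ ih =>
    intro n f
    obtain ⟨_, ⟨φ, h1, h1'⟩, ⟨ψ, h2, h2'⟩⟩ := ih f
    refine ⟨by simp, ⟨ψ, .ofPi h2, h2'⟩, ⟨φ, .ofSigma h1, fun D hD v hv => ?_⟩⟩
    rw [h1' D hD v hv, not_not]
  | @ex k ρ i _ ih =>
    intro n f
    obtain ⟨_, ⟨φ, h1, h1'⟩, ⟨ψ, h2, h2'⟩⟩ :=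
      ih (Function.update (fun l => (f l).castSucc) i (Fin.last n))
    refine ⟨by simp, ⟨_, .ex h1, fun D hD v hv => ?_⟩, ⟨_, .all h2, fun D hD v hv => ?_⟩⟩
    · rw [RI_ex]
      refine exists_congr fun a => and_congr_right fun hDa => ?_
      rw [h1' D hD _ (snoc_mem hv hDa), key]
    · simp only [RI]
      push Not
      refine forall_congr' fun a => forall_congr' fun hDa => ?_
      rw [h2' D hD _ (snoc_mem hv hDa), key]

/-- Semantic elementarity. -/
def SEl (N : Type 1) [DecidableEq N] (k : ℕ) (D T : Z → Prop) : Prop :=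
  ∀ ρ, Fam N k ρ → ∀ s : N → Z, (∀ i, D (s i)) → (ρ D s ↔ ρ T s)

/-- the values of a member of the family only depend on finitely many names -/
lemma Fam.finite {k : ℕ} {ρ} (h : Fam N k ρ) : ∃ F : Finset N, ∀ D s t,
    (∀ i ∈ F, s i = t i) → (ρ D s ↔ ρ D t) := by
  induction h with
  | mem i j => exact ⟨{i, j}, fun D s t h => by beta_reduce; rw [h i (by simp), h j (by simp)]⟩
  | eq i j => exact ⟨{i, j}, fun D s t h => by beta_reduce; rw [h i (by simp), h j (by simp)]⟩
  | fal => exact ⟨∅, fun D s t h => Iff.rfl⟩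
  | imp _ _ ih1 ih2 =>
    obtain ⟨F, h1⟩ := ih1
    obtain ⟨G, h2⟩ := ih2
    exact ⟨F ∪ G, fun D s t h => by
      beta_reduce; rw [h1 D s t (fun i hi => h i (by simp [hi])), h2 D s t (fun i hi => h i (by simp [hi]))]⟩
  | ball i j hij _ ih =>
    obtain ⟨F, h1⟩ := ih
    refine ⟨insert j F, fun D s t h => ?_⟩
    beta_reduce; rw [h j (by simp)]
    refine forall_congr' fun a => forall_congr' fun ha => h1 D _ _ fun l hl => ?_
    by_cases hli : l = i
    · subst hli; simp
    · simp [Function.update_of_ne hli, h l (by simp [hl])]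
  | neg _ ih =>
    obtain ⟨F, h1⟩ := ih
    exact ⟨F, fun D s t h => not_congr (h1 D s t h)⟩
  | ex i _ ih =>
    obtain ⟨F, h1⟩ := ih
    refine ⟨F, fun D s t h => ?_⟩
    refine exists_congr fun a => and_congr_right fun ha => h1 D _ _ fun l hl => ?_
    by_cases hli : l = i
    · subst hli; simp
    · simp [Function.update_of_ne hli, h l hl]

theorem sigmaElem_iff [Infinite N] {k : ℕ} {D T : Z → Prop} (hD : TC D) (hT : TC T)
    (hDT : ∀ x, D x → T x) (hne : ∃ x, D x) :
    SigmaElemPairE zmem k D T ↔ SEl N k D T := by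
  obtain ⟨c, hc⟩ : ∃ c : ℕ → N, Function.Injective c :=
    ⟨Infinite.natEmbedding N, (Infinite.natEmbedding N).injective⟩
  constructor
  · rintro ⟨_, h⟩ ρ hρ s hs
    obtain ⟨F, hF⟩ := hρ.finite
    obtain ⟨x0, hx0⟩ := hne
    -- enumerate `F`
    let e := F.equivFin
    let f : N → Fin (F.card + 1) := fun i => if hi : i ∈ F then (e ⟨i, hi⟩).castSucc else Fin.last _
    let v : Fin (F.card + 1) → Z := Fin.snoc (α := fun _ => Z) (fun i => s (e.symm i)) x0
    have hv : ∀ i, D (v i) := snoc_mem (fun i => hs _) hx0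
    have hvf : ∀ i ∈ F, v (f i) = s i := by
      intro i hi
      simp [v, f, hi]
    obtain ⟨φ, hφ, hφ'⟩ := (fam_sigma hρ f).2.1
    have h1 := h φ hφ v hv
    rw [realizeIn_iff, realizeIn_iff, hφ' D hD v hv, hφ' T hT v (fun i => hDT _ (hv i)),
      hF D _ s hvf, hF T _ s hvf] at h1
    have h2 : ∀ i, T (v i) := fun i => hDT _ (hv i)
    tauto
  · intro h
    refine ⟨hDT, fun n φ hφ v hv => ?_⟩
    obtain ⟨x0, hx0⟩ := hne
    obtain ⟨ρ, hρ, hρ'⟩ := sigma_cap c hc hφ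
    classical
    let s : N → Z := fun i => if hi : ∃ l : Fin n, c l = i then v hi.choose else x0
    have hs : ∀ i, D (s i) := by
      intro i
      simp only [s]
      split_ifs
      · exact hv _
      · exact hx0
    have hsv : (fun i : Fin n => s (c i)) = v := by
      funext i
      have hi : ∃ l : Fin n, c l = c i := ⟨i, rfl⟩
      simp only [s, dif_pos hi]
      congr 1
      exact Fin.ext (hc hi.choose_spec)
    have h1 := hρ' D hD s (fun i => hs _)
    have h2 := hρ' T hT s (fun i => hDT _ (hs _))
    rw [hsv] at h1 h2
    beta_reduce at h1 h2
    rw [realizeIn_iff, realizeIn_iff, h1, h2, h ρ hρ s hs]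
    have h3 : ∀ i, T (v i) := fun i => hDT _ (hv i)
    tauto

lemma fam_up {j : ℕ} {D T : Z → Prop} (hDT : ∀ x, D x → T x) (h : SEl N j D T) {ρ}
    (hρ : Fam N (j+1) ρ) : ∀ s : N → Z, (∀ i, D (s i)) → ρ D s → ρ T s := by
  generalize hk : j + 1 = k at hρ
  induction hρ with
  | @neg k ρ h1 _ =>
    obtain rfl : j = k := by omega
    intro s hs
    beta_reduce
    rw [h _ h1 s hs]; exact id
  | ex i _ ih =>
    rintro s hs ⟨a, ha, h2⟩
    refine ⟨a, hDT a ha, ih hk _ (fun l => ?_) h2⟩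
    by_cases hl : l = i
    · subst hl; simpa using ha
    · simpa [Function.update_of_ne hl] using hs l
  | _ => omega

end

lemma IsSigma.succ {k n : ℕ} {φ : SetFormula n} (h : IsSigma k φ) : IsSigma (k+1) φ := by
  refine @IsSigma.rec (fun k n φ _ => IsSigma (k+1) φ) (fun k n φ _ => IsPi (k+1) φ)
    ?_ ?_ ?_ ?_ ?_ ?_ k n φ h
  · exact fun h => .ofDelta0 h
  · exact fun _ h => .ofPi h
  · exact fun _ h => .ex h
  · exact fun h => .ofDelta0 h
  · exact fun _ h => .ofSigma h
  · exact fun _ h => .all h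

lemma IsSigma.mono {k l n : ℕ} (hkl : k ≤ l) {φ : SetFormula n} (h : IsSigma k φ) : IsSigma l φ := by
  induction hkl with
  | refl => exact h
  | step _ ih => exact ih.succ

lemma CnE.mono {k l : ℕ} (hkl : k ≤ l) {α : Z} (h : CnE zmem l α) : CnE zmem k α :=
  ⟨h.1, h.2.1, fun _ φ hφ v hv => h.2.2 φ (hφ.mono hkl) v hv⟩

lemma delta0_abs {D T : Z → Prop} (hD : TC D) (hT : TC T) (hDT : ∀ x, D x → T x) {n : ℕ}
    {φ : SetFormula n} (h : IsDelta0 φ) (v : Fin n → Z) (hv : ∀ i, D (v i)) :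
    RI D φ v ↔ RI T φ v := by
  obtain ⟨ρ, hρ, h⟩ := delta0_fam (N := ULift.{1} ℕ) ULift.up ULift.up_injective h
  have hind : ∀ s, ρ D s ↔ ρ T s := by
    clear h
    generalize hk : 0 = k at hρ
    induction hρ with
    | imp _ _ ih1 ih2 => intro s; beta_reduce; rw [ih1 hk, ih2 hk]
    | ball i j _ _ ih => intro s; simp only [ih hk]
    | neg => omega
    | ex => omega
    | _ => intro s; rfl
  let s : ULift.{1} ℕ → Z := fun i => if hi : i.down < n then v ⟨i.down, hi⟩ else ∅
  have hs : (fun i : Fin n => s (ULift.up i)) = v := by funext i; simp [s]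
  have h1 := h D hD s (fun i => by simpa [s] using hv i)
  have h2 := h T hT s (fun i => hDT _ (by simpa [s] using hv i))
  rw [hs] at h1 h2
  rw [h1, h2, hind]

end Paper

namespace Paper
open ZFSet Ordinal Cardinal
open scoped ZFSet

lemma transE_iff {x : Z} : TransE zmem x ↔ x.IsTransitive :=
  ⟨fun h y hy z hz => h y hy z hz, fun h y hy _ hz => h y hy hz⟩

lemma subE_iff {x y : Z} : SubE zmem x y ↔ x ⊆ y := ⟨fun h z hz => h z hz, fun h _ hz => h hz⟩

lemma ordE_iff {x : Z} : OrdE zmem x ↔ x.IsOrdinal := by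
  rw [ZFSet.isOrdinal_iff_forall_mem_isTransitive]
  simp only [OrdE, transE_iff]; rfl

lemma upairE_iff {p a b : Z} : UPairE zmem p a b ↔ p = {a, b} := by
  constructor
  · intro h; ext z; rw [ZFSet.mem_pair]; exact h z
  · rintro rfl z; exact ZFSet.mem_pair

lemma opairE_iff {p a b : Z} : OPairE zmem p a b ↔ p = pair a b := by
  simp only [OPairE, upairE_iff]
  constructor
  · rintro ⟨s, t, rfl, rfl, rfl⟩; simp [pair]
  · rintro rfl; exact ⟨_, _, rfl, rfl, by simp [pair]⟩

lemma pairMemE_iff {f a b : Z} : PairMemE zmem f a b ↔ pair a b ∈ f := by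
  simp only [PairMemE, opairE_iff]
  exact ⟨by rintro ⟨p, h, rfl⟩; exact h, fun h => ⟨_, h, rfl⟩⟩

lemma isFuncE_iff {f a b : Z} : IsFuncE zmem f a b ↔ f ∈ funs a b := by
  rw [mem_funs]
  simp only [IsFuncE, pairMemE_iff, opairE_iff, IsFunc]
  constructor
  · rintro ⟨h1, h2⟩
    refine ⟨fun p hp => ?_, fun z hz => ?_⟩
    · obtain ⟨x, y, hx, hy, rfl⟩ := h1 p hp
      exact pair_mem_prod.2 ⟨hx, hy⟩
    · obtain ⟨⟨y, hy⟩, h⟩ := h2 z hz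
      exact ⟨y, hy, fun y' hy' => h _ _ hy' hy⟩
  · rintro ⟨h1, h2⟩
    refine ⟨fun p hp => ?_, fun z hz => ?_⟩
    · obtain ⟨x, hx, y, hy, rfl⟩ := mem_prod.1 (h1 hp)
      exact ⟨x, y, hx, hy, rfl⟩
    · obtain ⟨y, hy, h⟩ := h2 z hz
      exact ⟨⟨y, hy⟩, fun y1 y2 h1 h2 => (h _ h1).trans (h _ h2).symm⟩

lemma surj_card {f a b : Z} (h : SurjE zmem f a b) : card b ≤ card a := by
  rw [← Cardinal.lift_le.{1}, ← cardinalMk_coe_sort, ← cardinalMk_coe_sort]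
  have h2 : ∀ y : b, ∃ x : a, PairMemE zmem f x y := fun y => by
    obtain ⟨x, hx, hxy⟩ := h.2 y.1 y.2
    exact ⟨⟨x, hx⟩, hxy⟩
  choose g hg using h2
  refine Cardinal.mk_le_of_injective (f := g) fun y y' hyy => ?_
  have h3 := hg y
  have h4 := hg y'
  rw [← hyy] at h4
  exact Subtype.ext ((h.1.2 _ (g y).2).2 _ _ h3 h4)

lemma exists_bij {a b : Z} (h : card a = card b) : ∃ f, BijE zmem f a b := by
  rw [← Cardinal.lift_inj.{0,1}, ← cardinalMk_coe_sort, ← cardinalMk_coe_sort] at h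
  obtain ⟨e⟩ := Cardinal.eq.1 h
  let f : Z := ZFSet.range (fun x : a => pair x.1 (e x).1)
  have hf : ∀ x y, pair x y ∈ f ↔ ∃ hx : x ∈ a, (e ⟨x, hx⟩).1 = y := by
    intro x y
    simp only [f, ZFSet.mem_range, pair_inj]
    constructor
    · rintro ⟨i, rfl, rfl⟩; exact ⟨i.2, rfl⟩
    · rintro ⟨hx, rfl⟩; exact ⟨⟨x, hx⟩, rfl, rfl⟩
  have hfun : IsFuncE zmem f a b := by
    simp only [IsFuncE, pairMemE_iff, opairE_iff, hf]
    refine ⟨fun p hp => ?_, fun x hx => ⟨⟨_, hx, rfl⟩, ?_⟩⟩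
    · obtain ⟨i, rfl⟩ := ZFSet.mem_range.1 hp
      exact ⟨_, _, i.2, (e i).2, rfl⟩
    · rintro y y' ⟨_, rfl⟩ ⟨_, rfl⟩; rfl
  refine ⟨f, ⟨hfun, ?_⟩, hfun, ?_⟩
  · intro y hy
    refine ⟨(e.symm ⟨y, hy⟩).1, (e.symm ⟨y, hy⟩).2, ?_⟩
    rw [pairMemE_iff, hf]
    exact ⟨(e.symm ⟨y, hy⟩).2, by simp⟩
  · intro x x' y hx hx' h1 h2
    rw [pairMemE_iff, hf] at h1 h2
    obtain ⟨h1, rfl⟩ := h1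
    obtain ⟨h2, h3⟩ := h2
    have := e.injective (Subtype.ext h3)
    exact (congrArg Subtype.val this).symm

lemma bij_card {f a b : Z} (h : BijE zmem f a b) : card a = card b := by
  refine le_antisymm ?_ (surj_card h.1)
  rw [← Cardinal.lift_le.{1}, ← cardinalMk_coe_sort, ← cardinalMk_coe_sort]
  have h2 : ∀ x : a, ∃ y : b, PairMemE zmem f x y := fun x => by
    obtain ⟨⟨y, hy⟩, _⟩ := h.1.1.2 x.1 x.2
    obtain ⟨p, hp, hpo⟩ := id hy
    obtain ⟨x', y', hx', hy', hp'⟩ := h.1.1.1 p hp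
    rw [opairE_iff] at hpo hp'
    rw [hpo, pair_inj] at hp'
    obtain ⟨_, rfl⟩ := hp'
    exact ⟨⟨y, hy'⟩, hy⟩
  choose g hg using h2
  refine Cardinal.mk_le_of_injective (f := g) fun x x' hxx => ?_
  have h3 := hg x
  have h4 := hg x'
  rw [← hxx] at h4
  exact Subtype.ext (h.2.2 _ _ _ x.2 x'.2 h3 h4)

lemma ord_eq {x : Z} (hx : OrdE zmem x) : x.rank.toZFSet = x := (ordE_iff.1 hx).toZFSet_rank_eq

lemma ordE_toZFSet (o : Ordinal.{0}) : OrdE zmem o.toZFSet := ordE_iff.2 (ZFSet.isOrdinal_toZFSet o)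

lemma ord_mem {x y : Z} (hx : OrdE zmem x) (hy : y ∈ x) : OrdE zmem y :=
  ordE_iff.2 ((ordE_iff.1 hx).mem hy)

lemma ord_mem_iff {x y : Z} (hx : OrdE zmem x) (hy : OrdE zmem y) : x ∈ y ↔ x.rank < y.rank :=
  ((ordE_iff.1 hx).rank_lt_iff_mem (ordE_iff.1 hy)).symm

lemma ord_mem_iff' {x y : Z} (hy : OrdE zmem y) : x ∈ y ↔ OrdE zmem x ∧ x.rank < y.rank :=
  ⟨fun h => ⟨ord_mem hy h, rank_lt_of_mem h⟩, fun h => (ord_mem_iff h.1 hy).2 h.2⟩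

lemma ord_card {x : Z} (hx : OrdE zmem x) : card x = x.rank.card := by
  conv_lhs => rw [← ord_eq hx, card_toZFSet]

lemma cardE_iff {x : Z} : CardE zmem x ↔ OrdE zmem x ∧ x.rank.card.ord = x.rank := by
  refine and_congr_right fun hx => ?_
  constructor
  · intro h
    refine le_antisymm (Cardinal.ord_card_le _) ?_
    by_contra hlt
    push Not at hlt
    refine h (x.rank.card.ord).toZFSet ((ord_mem_iff (ordE_toZFSet _) hx).2 (by simpa using hlt)) ?_
    apply exists_bij
    rw [card_toZFSet, ord_card hx, Cardinal.card_ord]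
  · rintro h α hα ⟨f, hf⟩
    have h1 := bij_card hf
    have hα' := ord_mem hx hα
    rw [ord_card hα', ord_card hx] at h1
    have h2 := rank_lt_of_mem hα
    rw [← h, Cardinal.lt_ord, h1] at h2
    exact lt_irrefl _ h2

lemma rank_card_of_trans {t : Z} (ht : t.IsTransitive) : t.rank.card ≤ card t := by
  -- every ordinal below the rank of `t` is the rank of an element of `t`
  have key : ∀ o < t.rank, ∃ y ∈ t, rank y = o := by
    have : ∀ y : Z, ∀ o ≤ y.rank, y ∈ t → ∃ z ∈ t, rank z = o := by
      intro y
      induction y using ZFSet.inductionOn with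
      | _ y ih =>
        intro o ho hy
        rcases ho.lt_or_eq with h | h
        · obtain ⟨z, hz, hoz⟩ := lt_rank_iff.1 h
          exact ih z hz o hoz (ht y hy hz)
        · exact ⟨y, hy, h.symm⟩
    intro o ho
    obtain ⟨y, hy, hoy⟩ := lt_rank_iff.1 ho
    exact this y o hoy hy
  rw [← card_toZFSet, ← Cardinal.lift_le.{1}, ← cardinalMk_coe_sort, ← cardinalMk_coe_sort]
  have h2 : ∀ a : t.rank.toZFSet, ∃ y : t, rank y.1 = rank a.1 := by
    intro a
    have := rank_lt_of_mem a.2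
    rw [rank_toZFSet] at this
    obtain ⟨y, hy, h⟩ := key _ this
    exact ⟨⟨y, hy⟩, h⟩
  choose g hg using h2
  refine Cardinal.mk_le_of_injective (f := g) fun a b hab => ?_
  have := (hg a).symm.trans ((congrArg (fun y : t => rank y.1) hab).trans (hg b))
  refine Subtype.ext ?_
  have ha := ord_mem (ordE_toZFSet _) a.2
  have hb := ord_mem (ordE_toZFSet _) b.2
  rw [← ord_eq ha, ← ord_eq hb, this]

lemma hmem_iff {x θ : Z} (hθ : CardE zmem θ) :
    HMemE zmem x θ ↔ ∃ t : Z, t.IsTransitive ∧ x ⊆ t ∧ card t < θ.rank.card := by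
  simp only [HMemE, transE_iff, subE_iff]
  refine exists_congr fun t => and_congr_right fun ht => and_congr_right fun hx => ?_
  obtain ⟨h1, h2⟩ := cardE_iff.1 hθ
  constructor
  · rintro ⟨β, f, hβ, hf⟩
    refine (surj_card hf).trans_lt ?_
    rw [ord_card (ord_mem h1 hβ), ← Cardinal.lt_ord, h2]
    exact rank_lt_of_mem hβ
  · intro h
    obtain ⟨f, hf⟩ := exists_bij (a := (card t).ord.toZFSet) (b := t) (by simp)
    refine ⟨_, f, ?_, hf.1⟩
    refine (ord_mem_iff (ordE_toZFSet _) h1).2 ?_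
    rw [rank_toZFSet, ← h2]
    exact Cardinal.ord_lt_ord.2 h

lemma hmem_rank {x θ : Z} (hθ : CardE zmem θ) (h : HMemE zmem x θ) : x.rank < θ.rank := by
  obtain ⟨t, ht, hx, hc⟩ := (hmem_iff hθ).1 h
  refine (rank_mono hx).trans_lt ?_
  rw [← (cardE_iff.1 hθ).2, Cardinal.lt_ord]
  exact (rank_card_of_trans ht).trans_lt hc

lemma hmem_ord {α θ : Z} (hθ : CardE zmem θ) (h : α ∈ θ) : HMemE zmem α θ := by
  have hα := ord_mem hθ.1 h
  refine (hmem_iff hθ).2 ⟨α, transE_iff.1 hα.1, fun _ h => h, ?_⟩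
  rw [ord_card hα, ← Cardinal.lt_ord, (cardE_iff.1 hθ).2]
  exact rank_lt_of_mem h

lemma hmem_sub {x y θ : Z} (h : HMemE zmem x θ) (hy : y ⊆ x) : HMemE zmem y θ := by
  obtain ⟨t, ht, hx, h⟩ := h
  exact ⟨t, ht, fun z hz => hx z (hy hz), h⟩

lemma hmem_mem {x y θ : Z} (h : HMemE zmem x θ) (hy : y ∈ x) : HMemE zmem y θ := by
  obtain ⟨t, ht, hx, h⟩ := h
  exact ⟨t, ht, fun z hz => ht y (hx y hy) z hz, h⟩

lemma vmem_iff {x α : Z} : VMemE zmem x α ↔ OrdE zmem α ∧ x.rank < α.rank := by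
  refine and_congr_right fun hα => ?_
  simp only [VHierE, pairMemE_iff, subE_iff]
  constructor
  · rintro ⟨f, ⟨-, hf⟩, β, u, hβ, hu, hxu⟩
    have key : ∀ β : Z, β ∈ α → ∀ w, pair β w ∈ f → w = V_ (rank β) := by
      intro β
      induction β using ZFSet.inductionOn with
      | _ β ih =>
        intro hβ w hw
        obtain ⟨⟨w', hw', h⟩, huniq⟩ := hf β hβ
        obtain rfl := huniq w w' hw hw'
        have hβo := ord_mem hα hβ
        ext z
        refine (h z).trans ?_
        rw [mem_vonNeumann']
        constructor
        · rintro ⟨γ, hγ, u, hu, hzu⟩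
          have hγα : γ ∈ α := hα.1 β hβ γ hγ
          rw [ih γ hγ hγα u hu] at hzu
          exact ⟨_, rank_lt_of_mem hγ, hzu⟩
        · rintro ⟨a, ha, hza⟩
          have hγ : a.toZFSet ∈ β := (ord_mem_iff (ordE_toZFSet _) hβo).2 (by simpa using ha)
          have hγα : a.toZFSet ∈ α := hα.1 β hβ _ hγ
          obtain ⟨⟨u, hu, -⟩, -⟩ := hf _ hγα
          refine ⟨_, hγ, u, hu, ?_⟩
          rw [ih _ hγ hγα u hu]
          simpa using hza
    have := key β hβ u hu
    subst this
    exact (subset_vonNeumann.1 hxu).trans_lt (rank_lt_of_mem hβ)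
  · intro h
    let f : Z := ZFSet.range (fun b : α => pair b.1 (V_ (rank b.1)))
    have hf : ∀ x y, pair x y ∈ f ↔ x ∈ α ∧ y = V_ (rank x) := by
      intro x y
      simp only [f, ZFSet.mem_range, pair_inj]
      constructor
      · rintro ⟨i, rfl, rfl⟩; exact ⟨i.2, rfl⟩
      · rintro ⟨hx, rfl⟩; exact ⟨⟨x, hx⟩, rfl, rfl⟩
    refine ⟨f, ⟨hα, fun β hβ => ⟨⟨V_ (rank β), (hf _ _).2 ⟨hβ, rfl⟩, fun z => ?_⟩, ?_⟩⟩, ?_⟩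
    · refine (mem_vonNeumann' (x := z)).trans ?_
      have hβo := ord_mem hα hβ
      constructor
      · rintro ⟨a, ha, hza⟩
        have hγ : a.toZFSet ∈ β := (ord_mem_iff (ordE_toZFSet _) hβo).2 (by simpa using ha)
        exact ⟨_, hγ, _, (hf _ _).2 ⟨hα.1 β hβ _ hγ, rfl⟩, by simpa using hza⟩
      · rintro ⟨γ, hγ, u, hu, hzu⟩
        obtain ⟨_, rfl⟩ := (hf _ _).1 hu
        exact ⟨_, rank_lt_of_mem hγ, hzu⟩
    · intro w w' h1 h2
      rw [((hf _ _).1 h1).2, ((hf _ _).1 h2).2]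
    · have hx : x.rank.toZFSet ∈ α := (ord_mem_iff (ordE_toZFSet _) hα).2 (by simpa using h)
      refine ⟨_, _, hx, (hf _ _).2 ⟨hx, rfl⟩, ?_⟩
      rw [rank_toZFSet]
      exact subset_vonNeumann_self x

/-- The class of sets of rank below `o`. -/
def VC (o : Ordinal.{0}) : Z → Prop := fun x => x.rank < o

lemma VC_tc (o : Ordinal.{0}) : TC (VC o) := fun _ hx _ hy => (rank_lt_of_mem hy).trans hx

lemma True_tc : TC (fun _ => True) := fun _ _ _ _ => trivial

lemma cnE_iff {n : ℕ} {α : Z} : CnE zmem n α ↔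
    OrdE zmem α ∧ SigmaElemPairE zmem n (VC α.rank) (fun _ => True) := by
  refine and_congr_right fun hα => ?_
  have : (fun x => VMemE zmem x α) = VC α.rank := by
    funext x; simp [vmem_iff, hα, VC]
  rw [this]

lemma cnE_zero {α : Z} (hα : OrdE zmem α) : CnE zmem 0 α := by
  refine cnE_iff.2 ⟨hα, fun _ _ => trivial, ?_⟩
  intro k φ hφ v hv
  rw [realizeIn_iff, realizeIn_iff]
  cases hφ with
  | ofDelta0 h =>
    rw [delta0_abs (VC_tc _) True_tc (fun _ _ => trivial) h v hv]
    simp only [implies_true, true_and, and_iff_right_iff_imp]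
    exact fun _ => hv

lemma ws_iff_zero {κ : Z} : WeaklyShrewdE zmem κ ↔ CnWeaklyShrewdE zmem 0 κ := by
  refine and_congr_right fun _ => ?_
  constructor
  · intro h φ θ z hθ _ hκ hz hr
    obtain ⟨κ', θ', z', h1, h2, h3, h4, h5⟩ := h φ θ z hθ hκ hz hr
    exact ⟨κ', θ', z', h1, h2, cnE_zero h2.1, h3, h4, h5⟩
  · intro h φ θ z hθ hκ hz hr
    obtain ⟨κ', θ', z', h1, h2, -, h3, h4, h5⟩ := h φ θ z hθ (cnE_zero hθ.1) hκ hz hr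
    exact ⟨κ', θ', z', h1, h2, h3, h4, h5⟩

end Paper

namespace Paper
open ZFSet Ordinal Cardinal
open scoped ZFSet

/-- Supertransitive classes. -/
def K1 (S : Z → Prop) : Prop := TC S ∧ ∀ x, S x → ∀ y, y ⊆ x → S y

/-- Rank-initial segments of limit height. -/
def K2 (S : Z → Prop) : Prop := ∃ ν : Ordinal.{0}, (∀ o < ν, o + 1 < ν) ∧ S = VC ν

lemma VC_K1 (o : Ordinal.{0}) : K1 (VC o) :=
  ⟨VC_tc o, fun _ hx _ hy => (rank_mono hy).trans_lt hx⟩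

lemma K2.K1 {S : Z → Prop} (h : K2 S) : K1 S := by
  obtain ⟨ν, -, rfl⟩ := h
  exact VC_K1 ν

/-- Uniform definability of `P` over the classes in `K`. -/
def Dfn (K : (Z → Prop) → Prop) (k : ℕ) (P : (Z → Prop) → (Fin k → Z) → Prop) : Prop :=
  ∃ φ : SetFormula k, ∀ S, K S → ∀ v, (∀ i, S (v i)) → (RI S φ v ↔ P S v)

namespace Dfn
variable {K : (Z → Prop) → Prop} {k : ℕ}

lemma congr {P Q : (Z → Prop) → (Fin k → Z) → Prop} (h : Dfn K k P)
    (hPQ : ∀ S, K S → ∀ v, (∀ i, S (v i)) → (Q S v ↔ P S v)) : Dfn K k Q := by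
  obtain ⟨φ, h⟩ := h
  exact ⟨φ, fun S hS v hv => (h S hS v hv).trans (hPQ S hS v hv).symm⟩

lemma anti {K' : (Z → Prop) → Prop} {P : (Z → Prop) → (Fin k → Z) → Prop} (h : Dfn K k P)
    (hK : ∀ S, K' S → K S) : Dfn K' k P := by
  obtain ⟨φ, h⟩ := h
  exact ⟨φ, fun S hS v hv => h S (hK S hS) v hv⟩

lemma mem (i j : Fin k) : Dfn K k (fun _ v => v i ∈ v j) := ⟨.mem i j, fun _ _ _ _ => Iff.rfl⟩
lemma eq (i j : Fin k) : Dfn K k (fun _ v => v i = v j) := ⟨.eq i j, fun _ _ _ _ => Iff.rfl⟩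
lemma fal : Dfn K k (fun _ _ => False) := ⟨.fal, fun _ _ _ _ => Iff.rfl⟩

lemma imp {P Q : (Z → Prop) → (Fin k → Z) → Prop} (hP : Dfn K k P) (hQ : Dfn K k Q) :
    Dfn K k (fun S v => P S v → Q S v) := by
  obtain ⟨φ, h⟩ := hP
  obtain ⟨ψ, h'⟩ := hQ
  exact ⟨φ.imp ψ, fun S hS v hv => by simp only [RI, h S hS v hv, h' S hS v hv]⟩

lemma not {P : (Z → Prop) → (Fin k → Z) → Prop} (hP : Dfn K k P) :
    Dfn K k (fun S v => ¬ P S v) := hP.imp fal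

lemma and {P Q : (Z → Prop) → (Fin k → Z) → Prop} (hP : Dfn K k P) (hQ : Dfn K k Q) :
    Dfn K k (fun S v => P S v ∧ Q S v) :=
  (hP.imp hQ.not).not.congr fun _ _ _ _ => by tauto

lemma or {P Q : (Z → Prop) → (Fin k → Z) → Prop} (hP : Dfn K k P) (hQ : Dfn K k Q) :
    Dfn K k (fun S v => P S v ∨ Q S v) :=
  (hP.not.imp hQ).congr fun _ _ _ _ => by tauto

lemma iff {P Q : (Z → Prop) → (Fin k → Z) → Prop} (hP : Dfn K k P) (hQ : Dfn K k Q) :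
    Dfn K k (fun S v => P S v ↔ Q S v) :=
  ((hP.imp hQ).and (hQ.imp hP)).congr fun _ _ _ _ => by tauto

lemma ne (i j : Fin k) : Dfn K k (fun _ v => v i ≠ v j) := (eq i j).not

lemma all {P : (Z → Prop) → (Fin k → Z) → Z → Prop}
    (h : Dfn K (k+1) (fun S v => P S (Fin.init v) (v (Fin.last k)))) :
    Dfn K k (fun S v => ∀ a, S a → P S v a) := by
  obtain ⟨φ, h⟩ := h
  refine ⟨φ.all, fun S hS v hv => ?_⟩
  simp only [RI]
  refine forall_congr' fun a => forall_congr' fun ha => ?_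
  rw [h S hS _ (snoc_mem hv ha)]
  simp [Fin.init_snoc, Fin.snoc_last]

lemma ex {P : (Z → Prop) → (Fin k → Z) → Z → Prop}
    (h : Dfn K (k+1) (fun S v => P S (Fin.init v) (v (Fin.last k)))) :
    Dfn K k (fun S v => ∃ a, S a ∧ P S v a) :=
  (all (P := fun S v a => ¬ P S v a) h.not).not.congr fun S _ v _ => by push Not; rfl

lemma ball1 (hK : ∀ S, K S → K1 S) (i : Fin k) {P : (Z → Prop) → (Fin k → Z) → Z → Prop}
    (h : Dfn K (k+1) (fun S v => P S (Fin.init v) (v (Fin.last k)))) :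
    Dfn K k (fun S v => ∀ a, a ∈ v i → P S v a) :=
  (all (P := fun S v a => a ∈ v i → P S v a) ((mem (Fin.last k) i.castSucc).imp h)).congr
    fun S hS v hv =>
      ⟨fun h a _ ha => h a ha, fun h a ha => h a ((hK S hS).1 _ (hv i) a ha) ha⟩

lemma bex1 (hK : ∀ S, K S → K1 S) (i : Fin k) {P : (Z → Prop) → (Fin k → Z) → Z → Prop}
    (h : Dfn K (k+1) (fun S v => P S (Fin.init v) (v (Fin.last k)))) :
    Dfn K k (fun S v => ∃ a, a ∈ v i ∧ P S v a) :=
  (ball1 hK i (P := fun S v a => ¬ P S v a) h.not).not.congr fun S _ v _ => by push Not; rfl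

lemma sub1 (hK : ∀ S, K S → K1 S) (i j : Fin k) : Dfn K k (fun _ v => v i ⊆ v j) :=
  (ball1 hK i (P := fun _ v a => a ∈ v j) (mem _ j.castSucc)).congr fun _ _ _ _ =>
    ⟨fun h _ ha => h ha, fun h _ ha => h _ ha⟩

lemma bsub1 (hK : ∀ S, K S → K1 S) (i : Fin k) {P : (Z → Prop) → (Fin k → Z) → Z → Prop}
    (h : Dfn K (k+1) (fun S v => P S (Fin.init v) (v (Fin.last k)))) :
    Dfn K k (fun S v => ∀ a, a ⊆ v i → P S v a) :=
  (all (P := fun S v a => a ⊆ v i → P S v a) ((sub1 hK (Fin.last k) i.castSucc).imp h)).congr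
    fun S hS v hv =>
      ⟨fun h a _ ha => h a ha, fun h a ha => h a ((hK S hS).2 _ (hv i) a ha) ha⟩

lemma bexsub1 (hK : ∀ S, K S → K1 S) (i : Fin k) {P : (Z → Prop) → (Fin k → Z) → Z → Prop}
    (h : Dfn K (k+1) (fun S v => P S (Fin.init v) (v (Fin.last k)))) :
    Dfn K k (fun S v => ∃ a, a ⊆ v i ∧ P S v a) :=
  (bsub1 hK i (P := fun S v a => ¬ P S v a) h.not).not.congr fun S _ v _ => by push Not; rfl

variable {k : ℕ}

lemma ball (i : Fin k) {P : (Z → Prop) → (Fin k → Z) → Z → Prop}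
    (h : Dfn K1 (k+1) (fun S v => P S (Fin.init v) (v (Fin.last k)))) :
    Dfn K1 k (fun S v => ∀ a, a ∈ v i → P S v a) := ball1 (fun _ h => h) i h
lemma bex (i : Fin k) {P : (Z → Prop) → (Fin k → Z) → Z → Prop}
    (h : Dfn K1 (k+1) (fun S v => P S (Fin.init v) (v (Fin.last k)))) :
    Dfn K1 k (fun S v => ∃ a, a ∈ v i ∧ P S v a) := bex1 (fun _ h => h) i h
lemma sub (i j : Fin k) : Dfn K1 k (fun _ v => v i ⊆ v j) := sub1 (fun _ h => h) i j
lemma bsub (i : Fin k) {P : (Z → Prop) → (Fin k → Z) → Z → Prop}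
    (h : Dfn K1 (k+1) (fun S v => P S (Fin.init v) (v (Fin.last k)))) :
    Dfn K1 k (fun S v => ∀ a, a ⊆ v i → P S v a) := bsub1 (fun _ h => h) i h
lemma bexsub (i : Fin k) {P : (Z → Prop) → (Fin k → Z) → Z → Prop}
    (h : Dfn K1 (k+1) (fun S v => P S (Fin.init v) (v (Fin.last k)))) :
    Dfn K1 k (fun S v => ∃ a, a ⊆ v i ∧ P S v a) := bexsub1 (fun _ h => h) i h

lemma k2 {P : (Z → Prop) → (Fin k → Z) → Prop} (h : Dfn K1 k P) : Dfn K2 k P :=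
  h.anti fun _ h => h.K1

lemma trans (i : Fin k) : Dfn K1 k (fun _ v => TransE zmem (v i)) :=
  ball i (ball _ (mem _ _))

lemma ord (i : Fin k) : Dfn K1 k (fun _ v => OrdE zmem (v i)) :=
  (trans i).and (ball i (trans _))

lemma isUPair (i j l : Fin k) : Dfn K1 k (fun _ v => v i = {v j, v l}) :=
  ((mem j i).and ((mem l i).and
    (ball i (P := fun _ v a => a = v j ∨ a = v l) ((eq _ _).or (eq _ _))))).congr
    fun S _ v _ => by
      constructor
      · intro h
        rw [h]
        simp
      · rintro ⟨h1, h2, h3⟩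
        ext z
        rw [mem_pair]
        exact ⟨h3 z, by rintro (rfl | rfl) <;> assumption⟩

lemma isPair (i j l : Fin k) : Dfn K1 k (fun _ v => v i = pair (v j) (v l)) :=
  (bex i (P := fun _ v s => ∃ t, t ∈ v i ∧ s = {v j, v j} ∧ t = {v j, v l} ∧ v i = {s, t})
    (bex _ ((isUPair _ _ _).and ((isUPair _ _ _).and (isUPair _ _ _))))).congr
    fun S _ v _ => by
      constructor
      · intro h
        rw [h]
        exact ⟨{v j}, by simp [pair], {v j, v l}, by simp [pair], by simp, rfl, rfl⟩
      · rintro ⟨s, -, t, -, rfl, rfl, h⟩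
        rw [h]; simp [pair]

lemma pairMem (i j l : Fin k) : Dfn K1 k (fun _ v => pair (v j) (v l) ∈ v i) :=
  (bex i (P := fun _ v p => p = pair (v j) (v l)) (isPair _ _ _)).congr fun S _ v _ => by simp

end Dfn

lemma funs_iff {f a b : Z} : f ∈ funs a b ↔ (∀ p, p ∈ f → ∃ x, x ∈ a ∧ ∃ y, y ∈ b ∧ p = pair x y) ∧
    ∀ x, x ∈ a → (∃ y, y ∈ b ∧ pair x y ∈ f) ∧ ∀ y, y ∈ b → ∀ y', y' ∈ b →
      pair x y ∈ f → pair x y' ∈ f → y = y' := by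
  rw [mem_funs]
  constructor
  · rintro ⟨h1, h2⟩
    refine ⟨fun p hp => ?_, fun x hx => ?_⟩
    · obtain ⟨x, hx, y, hy, rfl⟩ := mem_prod.1 (h1 hp)
      exact ⟨x, hx, y, hy, rfl⟩
    · obtain ⟨y, hy, h⟩ := h2 x hx
      exact ⟨⟨y, (pair_mem_prod.1 (h1 hy)).2, hy⟩,
        fun y1 _ y2 _ h1 h2 => (h _ h1).trans (h _ h2).symm⟩
  · rintro ⟨h1, h2⟩
    have h3 : ∀ x y, pair x y ∈ f → y ∈ b := by
      intro x y h
      obtain ⟨x', hx', y', hy', h⟩ := h1 _ h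
      rw [pair_inj] at h
      rw [h.2]; exact hy'
    refine ⟨fun p hp => ?_, fun z hz => ?_⟩
    · obtain ⟨x, hx, y, hy, rfl⟩ := h1 p hp
      exact pair_mem_prod.2 ⟨hx, hy⟩
    · obtain ⟨⟨y, -, hy⟩, h⟩ := h2 z hz
      exact ⟨y, hy, fun y' hy' => h _ (h3 _ _ hy') _ (h3 _ _ hy) hy' hy⟩

lemma Dfn.func {k : ℕ} (f a b : Fin k) : Dfn K1 k (fun _ v => v f ∈ funs (v a) (v b)) :=
  Dfn.congr (P := fun _ v =>
    (∀ p, p ∈ v f → ∃ x, x ∈ v a ∧ ∃ y, y ∈ v b ∧ p = pair x y) ∧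
    ∀ x, x ∈ v a → (∃ y, y ∈ v b ∧ pair x y ∈ v f) ∧ ∀ y, y ∈ v b → ∀ y', y' ∈ v b →
      pair x y ∈ v f → pair x y' ∈ v f → y = y')
    ((ball f (bex _ (bex _ (isPair _ _ _)))).and
      (ball a ((bex _ (pairMem _ _ _)).and (ball _ (ball _
        ((pairMem _ _ _).imp ((pairMem _ _ _).imp (eq _ _)))))))) fun _ _ _ _ => funs_iff

lemma Dfn.surj {k : ℕ} (f a b : Fin k) : Dfn K1 k (fun _ v => SurjE zmem (v f) (v a) (v b)) :=
  Dfn.congr (P := fun _ v => v f ∈ funs (v a) (v b) ∧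
    ∀ y, y ∈ v b → ∃ x, x ∈ v a ∧ pair x y ∈ v f)
    ((func _ _ _).and (ball b (bex _ (pairMem _ _ _)))) fun _ _ _ _ => by
      simp only [SurjE, isFuncE_iff, pairMemE_iff]; rfl

lemma bij_iff {f a b : Z} : BijE zmem f a b ↔ SurjE zmem f a b ∧
    ∀ x, x ∈ a → ∀ x', x' ∈ a → ∀ y, y ∈ b → pair x y ∈ f → pair x' y ∈ f → x = x' := by
  simp only [BijE, InjE, pairMemE_iff]
  refine and_congr_right fun h => ?_
  constructor
  · rintro ⟨-, h⟩ x hx x' hx' y _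
    exact h x x' y hx hx'
  · intro h1
    refine ⟨h.1, fun x x' y hx hx' h2 h3 => h1 x hx x' hx' y ?_ h2 h3⟩
    have := (mem_funs.1 (isFuncE_iff.1 h.1)).1 h2
    exact (pair_mem_prod.1 this).2

lemma Dfn.bij {k : ℕ} (f a b : Fin k) : Dfn K1 k (fun _ v => BijE zmem (v f) (v a) (v b)) :=
  Dfn.congr (P := fun _ v => SurjE zmem (v f) (v a) (v b) ∧
    ∀ x, x ∈ v a → ∀ x', x' ∈ v a → ∀ y, y ∈ v b → pair x y ∈ v f → pair x' y ∈ v f → x = x')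
    ((surj _ _ _).and (ball a (ball _ (ball _
      ((pairMem _ _ _).imp ((pairMem _ _ _).imp (eq _ _))))))) fun _ _ _ _ => bij_iff

lemma K2.pow {S : Z → Prop} (h : K2 S) {x : Z} (hx : S x) : S (powerset x) := by
  obtain ⟨ν, h, rfl⟩ := h
  simp only [VC, rank_powerset] at hx ⊢
  exact h _ hx

lemma K2.union {S : Z → Prop} (h : K2 S) {x y : Z} (hx : S x) (hy : S y) : S (x ∪ y) := by
  obtain ⟨ν, h, rfl⟩ := h
  simp only [VC, rank_union] at hx hy ⊢
  exact max_lt hx hy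

lemma K2.sub {S : Z → Prop} (h : K2 S) {x y : Z} (hx : S x) (hy : y ⊆ x) : S y := h.K1.2 x hx y hy

lemma prod_sub (a b : Z) : prod a b ⊆ powerset (powerset (a ∪ b)) := by
  intro p hp
  obtain ⟨x, hx, y, hy, rfl⟩ := mem_prod.1 hp
  rw [mem_powerset]
  intro q hq
  rw [mem_powerset]
  intro z hz
  simp only [pair, mem_pair] at hq
  rw [mem_union]
  rcases hq with rfl | rfl
  · rw [mem_singleton] at hz; subst hz; exact Or.inl hx
  · rw [mem_pair] at hz
    rcases hz with rfl | rfl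
    · exact Or.inl hx
    · exact Or.inr hy

lemma K2.func {S : Z → Prop} (h : K2 S) {f a b : Z} (ha : S a) (hb : S b) (hf : f ∈ funs a b) :
    S f :=
  h.sub (h.pow (h.pow (h.union ha hb))) fun _ hp => prod_sub a b ((mem_funs.1 hf).1 hp)

lemma K2.funs {S : Z → Prop} (h : K2 S) {a b : Z} (ha : S a) (hb : S b) : S (funs a b) :=
  h.sub (h.pow (h.pow (h.pow (h.union ha hb)))) fun _ hf =>
    mem_powerset.2 fun _ hp => prod_sub a b ((mem_funs.1 hf).1 hp)

lemma Dfn.card {k : ℕ} (i : Fin k) : Dfn K2 k (fun _ v => CardE zmem (v i)) :=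
  Dfn.congr (P := fun S v => OrdE zmem (v i) ∧ ∀ α, α ∈ v i → ¬ ∃ f, S f ∧ BijE zmem f α (v i))
    ((ord i).k2.and (ball1 (fun _ h => h.K1) i
      (ex (P := fun _ v a => BijE zmem a (v (Fin.last k)) (v i.castSucc)) (bij _ _ _).k2).not))
    fun S hS v hv => by
      refine and_congr_right fun _ => forall_congr' fun α => forall_congr' fun hα => not_congr ?_
      refine exists_congr fun f => ⟨fun h => ⟨?_, h⟩, fun h => h.2⟩
      exact hS.func (hS.K1.1 _ (hv i) α hα) (hv i) (isFuncE_iff.1 h.1.1)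

/-- `x ∈ H(θ)` for a cardinal `θ`. -/
def HM (θ x : Z) : Prop := CardE zmem θ ∧ HMemE zmem x θ

lemma K2.hm {S : Z → Prop} (h : K2 S) {θ x : Z} (hθ : S θ) (hx : HM θ x) : S x := by
  obtain ⟨ν, -, rfl⟩ := h
  exact (hmem_rank hx.1 hx.2).trans hθ

lemma Dfn.hm {k : ℕ} (i j : Fin k) : Dfn K2 k (fun _ v => HM (v i) (v j)) :=
  Dfn.congr (P := fun S v => CardE zmem (v i) ∧ ∃ t, S t ∧ TransE zmem t ∧ v j ⊆ t ∧
      ∃ β, β ∈ v i ∧ ∃ f, S f ∧ SurjE zmem f β t)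
    ((card i).and (ex ((trans _).k2.and ((sub _ _).k2.and (bex1 (fun _ h => h.K1) _
      (ex (P := fun _ v a => SurjE zmem a (v (Fin.last (k+1))) (v (Fin.last k).castSucc))
        (surj _ _ _).k2))))))
    fun S hS v hv => by
      refine and_congr_right fun hc => ?_
      simp only [HMemE, subE_iff]
      constructor
      · rintro ⟨t, ht, hx, β, f, hβ, hf⟩
        have hSt : S t := hS.hm (hv i) ⟨hc, t, ht, fun _ h => h, β, f, hβ, hf⟩
        exact ⟨t, hSt, ht, hx, β, hβ, f, hS.func (hS.K1.1 _ (hv i) β hβ) hSt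
          (isFuncE_iff.1 hf.1), hf⟩
      · rintro ⟨t, hSt, ht, hx, β, hβ, f, hSf, hf⟩
        exact ⟨t, ht, hx, β, f, hβ, hf⟩

lemma Dfn.relH {m : ℕ} (φ : SetFormula m) : ∀ {k : ℕ} (i : Fin k) (f : Fin m → Fin k),
    Dfn K2 k (fun _ v => RI (HM (v i)) φ (fun l => v (f l))) := by
  induction φ with
  | mem a b => exact fun i f => mem _ _
  | eq a b => exact fun i f => eq _ _
  | fal => exact fun i f => fal
  | imp φ ψ ih1 ih2 => exact fun i f => (ih1 i f).imp (ih2 i f)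
  | @all m φ ih =>
    intro k i f
    refine Dfn.congr (P := fun S v => ∀ a, S a → HM (v i) a →
      RI (HM (v i)) φ (Fin.snoc (fun l => v (f l)) a)) (all ((hm i.castSucc (Fin.last k)).imp ?_)) ?_
    · refine (ih i.castSucc
        (Fin.snoc (α := fun _ => Fin (k+1)) (fun l => (f l).castSucc) (Fin.last k))).congr ?_
      intro S _ v _
      have : (Fin.snoc (α := fun _ => Z) (fun l => Fin.init (α := fun _ => Z) v (f l))
          (v (Fin.last k))) = fun l =>
          v (Fin.snoc (α := fun _ => Fin (k+1)) (fun l => (f l).castSucc) (Fin.last k) l) := by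
        funext l
        refine Fin.lastCases ?_ (fun l => ?_) l
        · simp
        · simp [Fin.init]
      rw [this]; rfl
    · intro S hS v hv
      simp only [RI]
      exact ⟨fun h a _ ha => h a ha, fun h a ha => h a (hS.hm (hv i) ha) ha⟩

/-- `x` is a level of the cumulative hierarchy. -/
def Level (x : Z) : Prop := ∃ h, h ⊆ x ∧ (∀ y, y ∈ x → ∃ c, c ∈ h ∧ y ⊆ c) ∧
  (∀ c, c ∈ h → ∀ y, y ⊆ c → y ∈ x) ∧
  ∀ a, a ∈ h → (∀ y, y ∈ a → ∃ c, c ∈ h ∧ c ∈ a ∧ y ⊆ c) ∧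
    (∀ c, c ∈ h → c ∈ a → ∀ y, y ⊆ c → y ∈ a)

lemma Dfn.level {k : ℕ} (i : Fin k) : Dfn K1 k (fun _ v => Level (v i)) :=
  bexsub i ((ball _ (bex _ (sub _ _))).and ((ball _ (bsub _ (mem _ _))).and
    (ball _ ((ball _ (bex _ ((mem _ _).and (sub _ _)))).and
      (ball _ ((mem _ _).imp (bsub _ (mem _ _))))))))

lemma level_iff {x : Z} : Level x ↔ x = V_ (rank x) := by
  constructor
  · rintro ⟨h, hx, h1, h2, h3⟩
    have key : ∀ a : Z, a ∈ h → a = V_ (rank a) := by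
      intro a
      induction a using ZFSet.inductionOn with
      | _ a ih =>
        intro ha
        obtain ⟨h4, h5⟩ := h3 a ha
        ext y
        rw [mem_vonNeumann]
        refine ⟨rank_lt_of_mem, fun hy => ?_⟩
        obtain ⟨z, hz, hyz⟩ := lt_rank_iff.1 hy
        obtain ⟨c, hc, hca, hzc⟩ := h4 z hz
        refine h5 c hc hca y ?_
        rw [ih c hca hc, subset_vonNeumann]
        exact hyz.trans (rank_mono hzc)
    ext y
    rw [mem_vonNeumann]
    refine ⟨rank_lt_of_mem, fun hy => ?_⟩
    obtain ⟨z, hz, hyz⟩ := lt_rank_iff.1 hy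
    obtain ⟨c, hc, hzc⟩ := h1 z hz
    refine h2 c hc y ?_
    rw [key c hc, subset_vonNeumann]
    exact hyz.trans (rank_mono hzc)
  · intro hx
    generalize rank x = o at hx
    subst hx
    let h : Z := ZFSet.range (fun b : o.toZFSet => V_ (rank b.1))
    have hh : ∀ c, c ∈ h ↔ ∃ a < o, c = V_ a := by
      intro c
      simp only [h, ZFSet.mem_range]
      constructor
      · rintro ⟨b, rfl⟩
        exact ⟨_, by simpa using rank_lt_of_mem b.2, rfl⟩
      · rintro ⟨a, ha, rfl⟩
        exact ⟨⟨a.toZFSet, toZFSet_mem_toZFSet_iff.2 ha⟩, by simp⟩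
    refine ⟨h, ?_, ?_, ?_, ?_⟩
    · intro c hc
      obtain ⟨a, ha, rfl⟩ := (hh c).1 hc
      exact vonNeumann_mem_of_lt ha
    · intro y hy
      obtain ⟨a, ha, hya⟩ := mem_vonNeumann'.1 hy
      exact ⟨_, (hh _).2 ⟨a, ha, rfl⟩, hya⟩
    · intro c hc y hy
      obtain ⟨a, ha, rfl⟩ := (hh c).1 hc
      exact mem_vonNeumann'.2 ⟨a, ha, hy⟩
    · intro a1 ha1
      obtain ⟨a, ha, rfl⟩ := (hh _).1 ha1
      constructor
      · intro y hy
        obtain ⟨b, hb, hyb⟩ := mem_vonNeumann'.1 hy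
        exact ⟨_, (hh _).2 ⟨b, hb.trans ha, rfl⟩, vonNeumann_mem_of_lt hb, hyb⟩
      · intro c hc hca y hy
        obtain ⟨b, hb, rfl⟩ := (hh c).1 hc
        exact mem_vonNeumann'.2 ⟨b, by simpa using hca, hy⟩

/-- `x = V_α`. -/
def IsV (x α : Z) : Prop := Level x ∧ OrdE zmem α ∧ α ⊆ x ∧ α ∉ x

lemma Dfn.isV {k : ℕ} (i j : Fin k) : Dfn K1 k (fun _ v => IsV (v i) (v j)) :=
  (level _).and ((ord _).and ((sub _ _).and (mem _ _).not))

lemma isV_iff {x α : Z} : IsV x α ↔ OrdE zmem α ∧ x = V_ (rank α) := by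
  simp only [IsV, level_iff]
  constructor
  · rintro ⟨h1, h2, h3, h4⟩
    refine ⟨h2, ?_⟩
    rw [h1, subset_vonNeumann] at h3
    rw [h1, mem_vonNeumann, not_lt] at h4
    rw [le_antisymm h3 h4]; exact h1
  · rintro ⟨h1, rfl⟩
    simp [h1, mem_vonNeumann, subset_vonNeumann]

/-- The sentence forcing a supertransitive class to be a rank segment. -/
def Theta (S : Z → Prop) : Prop :=
  (∀ α, S α → OrdE zmem α → ∃ x, S x ∧ IsV x α) ∧ ∀ a, S a → ∃ b, S b ∧ a ∈ b

lemma Dfn.theta {k : ℕ} : Dfn K1 k (fun S _ => Theta S) :=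
  (all ((ord _).imp (ex (isV _ _)))).and (all (ex (mem _ _)))

lemma hmem_K1 (θ : Z) : K1 (fun x => HMemE zmem x θ) :=
  ⟨fun _ hx _ hy => hmem_mem hx hy, fun _ hx _ hy => hmem_sub hx hy⟩

lemma theta_H {ν : Z} (hν : CardE zmem ν) (h : Theta (fun x => HMemE zmem x ν)) :
    (fun x => HMemE zmem x ν) = VC ν.rank ∧ ∀ o < ν.rank, o + 1 < ν.rank := by
  have h1 : ∀ o < ν.rank, HMemE zmem (V_ o) ν := by
    intro o ho
    obtain ⟨x, hx, hxo⟩ := h.1 o.toZFSet (hmem_ord hν ((ord_mem_iff (ordE_toZFSet _) hν.1).2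
      (by simpa using ho))) (ordE_toZFSet _)
    rw [isV_iff] at hxo
    rw [hxo.2] at hx
    simpa using hx
  refine ⟨?_, ?_⟩
  · funext x
    refine propext ⟨fun hx => hmem_rank hν hx, fun hx => ?_⟩
    exact hmem_sub (h1 _ hx) (subset_vonNeumann_self x)
  · intro o ho
    obtain ⟨b, hb, hob⟩ := h.2 _ (h1 o ho)
    have := rank_lt_of_mem hob
    rw [rank_vonNeumann] at this
    exact (Order.add_one_le_of_lt this).trans_lt (hmem_rank hν hb)

end Paper

namespace Paper
open ZFSet Ordinal Cardinal
open scoped ZFSet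

/-- value of a set function -/
noncomputable def val (s i : Z) : Z := by
  classical exact if h : ∃ a, pair i a ∈ s then h.choose else ∅

lemma pair_mem_iff {s J A i a : Z} (hs : s ∈ funs J A) (hi : i ∈ J) :
    pair i a ∈ s ↔ a = val s i := by
  obtain ⟨b, hb, hu⟩ := (mem_funs.1 hs).2 i hi
  have hex : ∃ a, pair i a ∈ s := ⟨b, hb⟩
  have hv : pair i (val s i) ∈ s := by
    simp only [val, dif_pos hex]
    exact hex.choose_spec
  constructor
  · intro h
    exact (hu _ h).trans (hu _ hv).symm
  · rintro rfl; exact hv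

lemma val_mem {s J A i : Z} (hs : s ∈ funs J A) (hi : i ∈ J) : val s i ∈ A :=
  (pair_mem_prod.1 ((mem_funs.1 hs).1 ((pair_mem_iff hs hi).2 rfl))).2

lemma funs_ext {s t J A : Z} (hs : s ∈ funs J A) (ht : t ∈ funs J A)
    (h : ∀ i, i ∈ J → val s i = val t i) : s = t := by
  have key : ∀ {s t : Z}, s ∈ funs J A → t ∈ funs J A → (∀ i, i ∈ J → val s i = val t i) →
      s ⊆ t := by
    intro s t hs ht h p hp
    obtain ⟨x, hx, y, hy, rfl⟩ := mem_prod.1 ((mem_funs.1 hs).1 hp)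
    rw [pair_mem_iff hs hx] at hp
    rw [pair_mem_iff ht hx, hp, h x hx]
  exact ZFSet.ext fun p => ⟨fun h1 => key hs ht h h1, fun h1 => key ht hs (fun i hi => (h i hi).symm) h1⟩

lemma exists_fun {J A : Z} (g : Z → Z) (hg : ∀ i, i ∈ J → g i ∈ A) :
    ∃ s, s ∈ funs J A ∧ ∀ i, i ∈ J → val s i = g i := by
  let f : Z := ZFSet.range (fun x : J => pair x.1 (g x.1))
  have hf : ∀ x y, pair x y ∈ f ↔ x ∈ J ∧ g x = y := by
    intro x y
    simp only [f, ZFSet.mem_range, pair_inj]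
    constructor
    · rintro ⟨i, rfl, rfl⟩; exact ⟨i.2, rfl⟩
    · rintro ⟨hx, rfl⟩; exact ⟨⟨x, hx⟩, rfl, rfl⟩
  have hfs : f ∈ funs J A := by
    rw [mem_funs]
    refine ⟨fun p hp => ?_, fun x hx => ⟨g x, (hf _ _).2 ⟨hx, rfl⟩, fun y hy => ((hf _ _).1 hy).2.symm⟩⟩
    obtain ⟨i, rfl⟩ := ZFSet.mem_range.1 hp
    exact pair_mem_prod.2 ⟨i.2, hg _ i.2⟩
  refine ⟨f, hfs, fun i hi => ?_⟩
  have := (pair_mem_iff hfs hi).2 rfl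
  exact ((hf _ _).1 this).2.symm

/-- `s` and `t` agree off `i`. -/
def Agree (J A i s t : Z) : Prop :=
  ∀ l, l ∈ J → l ≠ i → ∀ a, a ∈ A → pair l a ∈ s → pair l a ∈ t

/-- `s(i) ∈ t(j)` -/
def VIn (A s i t j : Z) : Prop :=
  ∃ a, a ∈ A ∧ ∃ b, b ∈ A ∧ pair i a ∈ s ∧ pair j b ∈ t ∧ a ∈ b

def VEq (A s i t j : Z) : Prop :=
  ∃ a, a ∈ A ∧ ∃ b, b ∈ A ∧ pair i a ∈ s ∧ pair j b ∈ t ∧ a = b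

lemma agree_iff {J A i s t : Z} (hs : s ∈ funs J A) (ht : t ∈ funs J A) :
    Agree J A i s t ↔ ∀ l, l ∈ J → l ≠ i → val t l = val s l := by
  refine forall_congr' fun l => forall_congr' fun hl => forall_congr' fun hli => ?_
  constructor
  · intro h
    have := h _ (val_mem hs hl) ((pair_mem_iff hs hl).2 rfl)
    rw [pair_mem_iff ht hl] at this
    exact this.symm
  · intro h a _ ha
    rw [pair_mem_iff hs hl] at ha
    rw [pair_mem_iff ht hl, h, ha]

lemma vin_iff {J A s i t j : Z} (hs : s ∈ funs J A) (ht : t ∈ funs J A) (hi : i ∈ J) (hj : j ∈ J) :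
    VIn A s i t j ↔ val s i ∈ val t j := by
  constructor
  · rintro ⟨a, -, b, -, h1, h2, h3⟩
    rw [pair_mem_iff hs hi] at h1
    rw [pair_mem_iff ht hj] at h2
    rwa [← h1, ← h2]
  · intro h
    exact ⟨_, val_mem hs hi, _, val_mem ht hj, (pair_mem_iff hs hi).2 rfl,
      (pair_mem_iff ht hj).2 rfl, h⟩

lemma veq_iff {J A s i t j : Z} (hs : s ∈ funs J A) (ht : t ∈ funs J A) (hi : i ∈ J) (hj : j ∈ J) :
    VEq A s i t j ↔ val s i = val t j := by
  constructor
  · rintro ⟨a, -, b, -, h1, h2, h3⟩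
    rw [pair_mem_iff hs hi] at h1
    rw [pair_mem_iff ht hj] at h2
    rwa [← h1, ← h2]
  · intro h
    exact ⟨_, val_mem hs hi, _, val_mem ht hj, (pair_mem_iff hs hi).2 rfl,
      (pair_mem_iff ht hj).2 rfl, h⟩

/-- closure conditions for level zero -/
def C0 (J e A W Q D : Z) : Prop :=
  (∀ i, i ∈ J → i ≠ e → ∀ j, j ∈ J → j ≠ e → ∀ R, R ∈ Q →
    (∀ s, s ∈ W → (s ∈ R ↔ VIn A s i s j)) → R ∈ D) ∧
  (∀ i, i ∈ J → i ≠ e → ∀ j, j ∈ J → j ≠ e → ∀ R, R ∈ Q →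
    (∀ s, s ∈ W → (s ∈ R ↔ VEq A s i s j)) → R ∈ D) ∧
  (∀ R, R ∈ Q → (∀ s, s ∈ W → (s ∈ R ↔ False)) → R ∈ D) ∧
  (∀ R1, R1 ∈ D → ∀ R2, R2 ∈ D → ∀ R, R ∈ Q →
    (∀ s, s ∈ W → (s ∈ R ↔ (s ∈ R1 → s ∈ R2))) → R ∈ D) ∧
  (∀ i, i ∈ J → i ≠ e → ∀ j, j ∈ J → j ≠ e → i ≠ j → ∀ R1, R1 ∈ D → ∀ R, R ∈ Q →
    (∀ s, s ∈ W → (s ∈ R ↔ ∀ t, t ∈ W → Agree J A i s t → VIn A t i s j → t ∈ R1)) → R ∈ D)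

/-- Internal version of `Fam`. -/
def FF (J e A W Q : Z) : ℕ → Z → Prop
  | 0, R => ∀ D, D ⊆ Q → C0 J e A W Q D → R ∈ D
  | k+1, R => ∀ D, D ⊆ Q →
      (∀ R1, R1 ∈ Q → FF J e A W Q k R1 → ∀ R, R ∈ Q → (∀ s, s ∈ W → (s ∈ R ↔ ¬ s ∈ R1)) → R ∈ D) →
      (∀ i, i ∈ J → i ≠ e → ∀ R1, R1 ∈ D → ∀ R, R ∈ Q →
        (∀ s, s ∈ W → (s ∈ R ↔ ∃ t, t ∈ W ∧ Agree J A i s t ∧ VIn A t i s e ∧ t ∈ R1)) → R ∈ D) →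
      R ∈ D

/-- Internal elementarity -/
def El (J e A W Q : Z) (k : ℕ) (x y : Z) : Prop :=
  ∀ R, R ∈ Q → FF J e A W Q k R → ∀ s, s ∈ W → ∀ t, t ∈ W → pair e x ∈ s → pair e y ∈ t →
    Agree J A e s t → (∀ i, i ∈ J → i ≠ e → VIn A s i s e) → (s ∈ R ↔ t ∈ R)

section dfn
variable {k : ℕ}
namespace Dfn

lemma agree (J A i s t : Fin k) : Dfn K1 k (fun _ v => Agree (v J) (v A) (v i) (v s) (v t)) :=
  ball _ ((ne _ _).imp (ball _ ((pairMem _ _ _).imp (pairMem _ _ _))))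

lemma vin (A s i t j : Fin k) : Dfn K1 k (fun _ v => VIn (v A) (v s) (v i) (v t) (v j)) :=
  bex _ (bex _ ((pairMem _ _ _).and ((pairMem _ _ _).and (mem _ _))))

lemma veq (A s i t j : Fin k) : Dfn K1 k (fun _ v => VEq (v A) (v s) (v i) (v t) (v j)) :=
  bex _ (bex _ ((pairMem _ _ _).and ((pairMem _ _ _).and (eq _ _))))

lemma c0 (J e A W Q D : Fin k) :
    Dfn K1 k (fun _ v => C0 (v J) (v e) (v A) (v W) (v Q) (v D)) :=
  (ball _ ((ne _ _).imp (ball _ ((ne _ _).imp (ball _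
    ((ball _ ((mem _ _).iff (vin _ _ _ _ _))).imp (mem _ _))))))).and <|
  (ball _ ((ne _ _).imp (ball _ ((ne _ _).imp (ball _
    ((ball _ ((mem _ _).iff (veq _ _ _ _ _))).imp (mem _ _))))))).and <|
  (ball _ ((ball _ ((mem _ _).iff fal)).imp (mem _ _))).and <|
  (ball _ (ball _ (ball _ ((ball _ ((mem _ _).iff ((mem _ _).imp (mem _ _)))).imp (mem _ _))))).and <|
  (ball _ ((ne _ _).imp (ball _ ((ne _ _).imp ((ne _ _).imp (ball _ (ball _
    ((ball _ ((mem _ _).iff (ball _ ((agree _ _ _ _ _).imp ((vin _ _ _ _ _).imp (mem _ _)))))).imp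
      (mem _ _)))))))))

lemma ff (n : ℕ) : ∀ {k : ℕ} (J e A W Q R : Fin k),
    Dfn K1 k (fun _ v => FF (v J) (v e) (v A) (v W) (v Q) n (v R)) := by
  induction n with
  | zero => exact fun J e A W Q R => bsub _ ((c0 _ _ _ _ _ _).imp (mem _ _))
  | succ n ih =>
    exact fun J e A W Q R => bsub _
      ((ball _ ((ih _ _ _ _ _ _).imp (ball _
        ((ball _ ((mem _ _).iff (mem _ _).not)).imp (mem _ _))))).imp
      ((ball _ ((ne _ _).imp (ball _ (ball _ ((ball _ ((mem _ _).iff (bex _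
        ((agree _ _ _ _ _).and ((vin _ _ _ _ _).and (mem _ _)))))).imp (mem _ _)))))).imp (mem _ _)))

lemma el (n : ℕ) (J e A W Q x y : Fin k) :
    Dfn K1 k (fun _ v => El (v J) (v e) (v A) (v W) (v Q) n (v x) (v y)) :=
  ball _ ((ff n _ _ _ _ _ _).imp (ball _ (ball _ ((pairMem _ _ _).imp ((pairMem _ _ _).imp
    ((agree _ _ _ _ _).imp ((ball _ ((ne _ _).imp (vin _ _ _ _ _))).imp
      ((mem _ _).iff (mem _ _)))))))))

end Dfn
end dfn

/-- the names -/
abbrev Nm (J e : Z) : Type 1 := {i : Z // i ∈ J ∧ i ≠ e}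

noncomputable instance (J e : Z) : DecidableEq (Nm J e) := Classical.decEq _

section enc
variable {J e A : Z}

/-- encoding of a relation -/
noncomputable def enc (J e A : Z) (ρ : (Z → Prop) → (Nm J e → Z) → Prop) : Z :=
  ZFSet.sep (fun s => ρ (fun a => a ∈ val s e) (fun i => val s i.1)) (funs J A)

lemma enc_mem (ρ) : enc J e A ρ ∈ powerset (funs J A) := mem_powerset.2 sep_subset

lemma mem_enc {ρ} {s : Z} (hs : s ∈ funs J A) :
    s ∈ enc J e A ρ ↔ ρ (fun a => a ∈ val s e) (fun i => val s i.1) := by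
  simp [enc, hs]

lemma eq_enc {ρ} {R : Z} (hR : R ∈ powerset (funs J A)) : R = enc J e A ρ ↔
    ∀ s, s ∈ funs J A → (s ∈ R ↔ ρ (fun a => a ∈ val s e) (fun i => val s i.1)) := by
  constructor
  · rintro rfl s hs; exact mem_enc hs
  · intro h
    ext s
    constructor
    · intro hs
      have := mem_powerset.1 hR hs
      exact (mem_enc this).2 ((h s this).1 hs)
    · intro hs
      have := mem_powerset.1 (enc_mem ρ) hs
      exact (h s this).2 ((mem_enc this).1 hs)

lemma exists_upd (i : Nm J e) {s a : Z} (hs : s ∈ funs J A) (ha : a ∈ A) :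
    ∃ t, t ∈ funs J A ∧ Agree J A i.1 s t ∧ val t i.1 = a := by
  classical
  obtain ⟨t, ht, h⟩ := exists_fun (J := J) (A := A) (Function.update (val s) i.1 a) (by
    intro l hl
    by_cases h : l = i.1
    · subst h; simpa using ha
    · rw [Function.update_of_ne h]; exact val_mem hs hl)
  refine ⟨t, ht, (agree_iff hs ht).2 fun l hl hli => ?_, ?_⟩
  · rw [h l hl, Function.update_of_ne hli]
  · rw [h _ i.2.1, Function.update_self]

lemma agree_upd (i : Nm J e) (he : e ∈ J) {s t : Z} (hs : s ∈ funs J A) (ht : t ∈ funs J A)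
    (h : Agree J A i.1 s t) : val t e = val s e ∧
      (fun l : Nm J e => val t l.1) = Function.update (fun l : Nm J e => val s l.1) i (val t i.1) := by
  rw [agree_iff hs ht] at h
  refine ⟨h e he i.2.2.symm, ?_⟩
  funext l
  by_cases hl : l = i
  · subst hl; simp
  · rw [Function.update_of_ne hl]
    exact h _ l.2.1 fun h => hl (Subtype.ext h)

lemma ball_spec (he : e ∈ J) (hA : A.IsTransitive) (i j : Nm J e) (ρ : (Z → Prop) → (Nm J e → Z) → Prop)
    {s : Z} (hs : s ∈ funs J A) :
    (∀ t, t ∈ funs J A → Agree J A i.1 s t → VIn A t i.1 s j.1 → t ∈ enc J e A ρ) ↔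
    ∀ a, a ∈ val s j.1 → ρ (fun a => a ∈ val s e) (Function.update (fun l => val s l.1) i a) := by
  constructor
  · intro h a ha
    obtain ⟨t, ht, hst, hta⟩ := exists_upd i hs (hA _ (val_mem hs j.2.1) ha)
    have := h t ht hst ((vin_iff ht hs i.2.1 j.2.1).2 (by rw [hta]; exact ha))
    rw [mem_enc ht, (agree_upd i he hs ht hst).1, (agree_upd i he hs ht hst).2, hta] at this
    exact this
  · intro h t ht hst hv
    rw [mem_enc ht, (agree_upd i he hs ht hst).1, (agree_upd i he hs ht hst).2]
    exact h _ ((vin_iff ht hs i.2.1 j.2.1).1 hv)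

lemma ex_spec (he : e ∈ J) (hA : A.IsTransitive) (i : Nm J e) (ρ : (Z → Prop) → (Nm J e → Z) → Prop)
    {s : Z} (hs : s ∈ funs J A) :
    (∃ t, t ∈ funs J A ∧ Agree J A i.1 s t ∧ VIn A t i.1 s e ∧ t ∈ enc J e A ρ) ↔
    ∃ a, a ∈ val s e ∧ ρ (fun a => a ∈ val s e) (Function.update (fun l => val s l.1) i a) := by
  constructor
  · rintro ⟨t, ht, hst, hv, h⟩
    rw [mem_enc ht, (agree_upd i he hs ht hst).1, (agree_upd i he hs ht hst).2] at h
    exact ⟨_, (vin_iff ht hs i.2.1 he).1 hv, h⟩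
  · rintro ⟨a, ha, h⟩
    obtain ⟨t, ht, hst, hta⟩ := exists_upd i hs (hA _ (val_mem hs he) ha)
    refine ⟨t, ht, hst, (vin_iff ht hs i.2.1 he).2 (by rw [hta]; exact ha), ?_⟩
    rw [mem_enc ht, (agree_upd i he hs ht hst).1, (agree_upd i he hs ht hst).2, hta]
    exact h

lemma ff_iff (he : e ∈ J) (hA : A.IsTransitive) (k : ℕ) : ∀ R,
    FF J e A (funs J A) (powerset (funs J A)) k R ↔ ∃ ρ, Fam (Nm J e) k ρ ∧ R = enc J e A ρ := by
  induction k with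
  | zero =>
    intro R
    constructor
    · intro h
      have := h (ZFSet.sep (fun R => ∃ ρ, Fam (Nm J e) 0 ρ ∧ R = enc J e A ρ)
        (powerset (funs J A))) sep_subset ?_
      · exact (ZFSet.mem_sep.1 this).2
      · refine ⟨?_, ?_, ?_, ?_, ?_⟩
        · intro i hi hie j hj hje R hR h
          refine ZFSet.mem_sep.2 ⟨hR, _, Fam.mem ⟨i, hi, hie⟩ ⟨j, hj, hje⟩, (eq_enc hR).2 ?_⟩
          intro s hs
          rw [h s hs, vin_iff hs hs hi hj]
        · intro i hi hie j hj hje R hR h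
          refine ZFSet.mem_sep.2 ⟨hR, _, Fam.eq ⟨i, hi, hie⟩ ⟨j, hj, hje⟩, (eq_enc hR).2 ?_⟩
          intro s hs
          rw [h s hs, veq_iff hs hs hi hj]
        · intro R hR h
          exact ZFSet.mem_sep.2 ⟨hR, _, Fam.fal, (eq_enc hR).2 h⟩
        · intro R1 h1 R2 h2 R hR h
          obtain ⟨-, ρ, g1, rfl⟩ := ZFSet.mem_sep.1 h1
          obtain ⟨-, σ, g2, rfl⟩ := ZFSet.mem_sep.1 h2
          refine ZFSet.mem_sep.2 ⟨hR, _, Fam.imp g1 g2, (eq_enc hR).2 ?_⟩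
          intro s hs
          rw [h s hs, mem_enc hs, mem_enc hs]
        · intro i hi hie j hj hje hij R1 h1 R hR h
          obtain ⟨-, ρ, g1, rfl⟩ := ZFSet.mem_sep.1 h1
          refine ZFSet.mem_sep.2 ⟨hR, _, Fam.ball ⟨i, hi, hie⟩ ⟨j, hj, hje⟩
            (fun h => hij (congrArg Subtype.val h)) g1, (eq_enc hR).2 ?_⟩
          intro s hs
          rw [h s hs]
          exact ball_spec he hA ⟨i, hi, hie⟩ ⟨j, hj, hje⟩ ρ hs
    · rintro ⟨ρ, hρ, rfl⟩ D hD ⟨h1, h2, h3, h4, h5⟩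
      generalize hk : 0 = k at hρ
      induction hρ with
      | mem i j =>
        refine h1 i.1 i.2.1 i.2.2 j.1 j.2.1 j.2.2 _ (enc_mem _) fun s hs => ?_
        rw [mem_enc hs, vin_iff hs hs i.2.1 j.2.1]
      | eq i j =>
        refine h2 i.1 i.2.1 i.2.2 j.1 j.2.1 j.2.2 _ (enc_mem _) fun s hs => ?_
        rw [mem_enc hs, veq_iff hs hs i.2.1 j.2.1]
      | fal => exact h3 _ (enc_mem _) fun s hs => mem_enc hs
      | imp _ _ ih1 ih2 =>
        refine h4 _ (ih1 hk) _ (ih2 hk) _ (enc_mem _) fun s hs => ?_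
        rw [mem_enc hs, mem_enc hs, mem_enc hs]
      | ball i j hij _ ih =>
        refine h5 i.1 i.2.1 i.2.2 j.1 j.2.1 j.2.2 (fun h => hij (Subtype.ext h)) _ (ih hk) _
          (enc_mem _) fun s hs => ?_
        rw [mem_enc hs]
        exact (ball_spec he hA i j _ hs).symm
      | neg => omega
      | ex => omega
  | succ k ihk =>
    intro R
    constructor
    · intro h
      have := h (ZFSet.sep (fun R => ∃ ρ, Fam (Nm J e) (k+1) ρ ∧ R = enc J e A ρ)
        (powerset (funs J A))) sep_subset ?_ ?_
      · exact (ZFSet.mem_sep.1 this).2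
      · intro R1 hR1 h1 R hR h
        obtain ⟨ρ, g1, rfl⟩ := (ihk _).1 h1
        refine ZFSet.mem_sep.2 ⟨hR, _, Fam.neg g1, (eq_enc hR).2 ?_⟩
        intro s hs
        rw [h s hs, mem_enc hs]
      · intro i hi hie R1 h1 R hR h
        obtain ⟨-, ρ, g1, rfl⟩ := ZFSet.mem_sep.1 h1
        refine ZFSet.mem_sep.2 ⟨hR, _, Fam.ex ⟨i, hi, hie⟩ g1, (eq_enc hR).2 ?_⟩
        intro s hs
        rw [h s hs]
        exact ex_spec he hA ⟨i, hi, hie⟩ ρ hs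
    · rintro ⟨ρ, hρ, rfl⟩ D hD h1 h2
      generalize hk : k + 1 = k' at hρ
      induction hρ with
      | @neg k1 ρ hρ _ =>
        obtain rfl : k = k1 := by omega
        refine h1 _ (enc_mem _) ((ihk _).2 ⟨ρ, hρ, rfl⟩) _ (enc_mem _) fun s hs => ?_
        rw [mem_enc hs, mem_enc hs]
      | ex i _ ih =>
        refine h2 i.1 i.2.1 i.2.2 _ (ih hk) _ (enc_mem _) fun s hs => ?_
        rw [mem_enc hs]
        exact (ex_spec he hA i _ hs).symm
      | _ => omega

lemma el_iff (he : e ∈ J) (hA : A.IsTransitive) (k : ℕ) {x y : Z} (hx : x ∈ A) (hy : y ∈ A) :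
    El J e A (funs J A) (powerset (funs J A)) k x y ↔
      SEl (Nm J e) k (fun a => a ∈ x) (fun a => a ∈ y) := by
  constructor
  · intro h ρ hρ s hs
    classical
    let g : Z → Z → Z := fun x i => if hi : i ∈ J ∧ i ≠ e then s ⟨i, hi⟩ else x
    have hgA : ∀ x, x ∈ A → ∀ i, i ∈ J → g x i ∈ A := by
      intro x1 hx1 i hi
      by_cases h : i ∈ J ∧ i ≠ e
      · simp only [g, dif_pos h]
        exact hA _ hx (hs _)
      · simp only [g, dif_neg h]
        exact hx1
    obtain ⟨s1, hs1, h1⟩ := exists_fun (g x) (hgA x hx)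
    obtain ⟨t1, ht1, h2⟩ := exists_fun (g y) (hgA y hy)
    have hge : ∀ x, g x e = x := fun x => by simp [g]
    have hgn : ∀ x, ∀ i : Nm J e, g x i.1 = s i := fun x i => by simp [g, i.2.1, i.2.2]
    have h3 := h (enc J e A ρ) (enc_mem _) ((ff_iff he hA k _).2 ⟨ρ, hρ, rfl⟩) s1 hs1 t1 ht1
      ((pair_mem_iff hs1 he).2 (by rw [h1 e he, hge])) ((pair_mem_iff ht1 he).2 (by rw [h2 e he, hge]))
      ((agree_iff hs1 ht1).2 fun l hl hle => by
        rw [h1 l hl, h2 l hl, hgn y ⟨l, hl, hle⟩, hgn x ⟨l, hl, hle⟩])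
      (fun i hi hie => (vin_iff hs1 hs1 hi he).2 (by
        rw [h1 i hi, h1 e he, hge, hgn x ⟨i, hi, hie⟩]; exact hs _))
    rw [mem_enc hs1, mem_enc ht1, h1 e he, h2 e he, hge, hge] at h3
    have h4 : (fun i : Nm J e => val s1 i.1) = s := by
      funext i; rw [h1 _ i.2.1, hgn]
    have h5 : (fun i : Nm J e => val t1 i.1) = s := by
      funext i; rw [h2 _ i.2.1, hgn]
    rwa [h4, h5] at h3
  · intro h R _ hF s hs t ht hsx hty hag hv
    obtain ⟨ρ, hρ, rfl⟩ := (ff_iff he hA k _).1 hF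
    rw [pair_mem_iff hs he] at hsx
    rw [pair_mem_iff ht he] at hty
    rw [mem_enc hs, mem_enc ht, ← hsx, ← hty]
    rw [agree_iff hs ht] at hag
    have h5 : (fun i : Nm J e => val t i.1) = (fun i : Nm J e => val s i.1) := by
      funext i; exact hag _ i.2.1 i.2.2
    rw [h5]
    refine h ρ hρ _ fun i => ?_
    rw [hsx]
    exact (vin_iff hs hs i.2.1 he).1 (hv i.1 i.2.1 i.2.2)

end enc

/-- `J` is infinite. -/
def InfJ (J : Z) : Prop := (∃ a, a ∈ J) ∧ ∀ a, a ∈ J → ∃ b, b ∈ J ∧ a ∈ b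

lemma Nm_infinite {J e : Z} (h : InfJ J) : Infinite (Nm J e) := by
  have h1 : Set.Infinite {i : Z | i ∈ J} := by
    intro hf
    obtain ⟨a, ha, hmax⟩ := Set.exists_max_image {i : Z | i ∈ J} rank hf h.1
    obtain ⟨b, hb, hab⟩ := h.2 a ha
    exact absurd (rank_lt_of_mem hab) (not_lt.2 (hmax b hb))
  have h2 := h1.sdiff (Set.finite_singleton e)
  have h3 : Infinite ↥({i : Z | i ∈ J} \ {e}) := h2.to_subtype
  exact h3

/-- Internal elementarity, with auxiliary sets quantified over `S`. -/
def ElS (S : Z → Prop) (J e : Z) (k : ℕ) (x y : Z) : Prop :=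
  ∀ A, S A → TransE zmem A → x ∈ A → y ∈ A → ∀ W, S W → W = funs J A →
    ∀ Q, S Q → Q = powerset W → El J e A W Q k x y

lemma Dfn.eqFuns {k : ℕ} (W J A : Fin k) : Dfn K2 k (fun _ v => v W = funs (v J) (v A)) :=
  Dfn.congr (P := fun S v => (∀ f, f ∈ v W → f ∈ funs (v J) (v A)) ∧
    ∀ f, S f → f ∈ funs (v J) (v A) → f ∈ v W)
    ((ball _ (func _ _ _)).k2.and (all ((func _ _ _).k2.imp (mem _ _)))) fun S hS v hv => by
      constructor
      · intro h
        rw [h]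
        exact ⟨fun _ h => h, fun _ _ h => h⟩
      · rintro ⟨h1, h2⟩
        ext f
        exact ⟨h1 f, fun hf => h2 f (hS.func (hv J) (hv A) hf) hf⟩

lemma Dfn.eqPow {k : ℕ} (Q W : Fin k) : Dfn K1 k (fun _ v => v Q = powerset (v W)) :=
  Dfn.congr (P := fun _ v => (∀ f, f ∈ v Q → f ⊆ v W) ∧ ∀ f, f ⊆ v W → f ∈ v Q)
    ((ball _ (sub _ _)).and (bsub _ (mem _ _))) fun S hS v hv => by
      constructor
      · intro h
        rw [h]
        exact ⟨fun _ h => mem_powerset.1 h, fun _ h => mem_powerset.2 h⟩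
      · rintro ⟨h1, h2⟩
        ext f
        rw [mem_powerset]
        exact ⟨h1 f, h2 f⟩

lemma Dfn.elS {k : ℕ} (n : ℕ) (J e x y : Fin k) :
    Dfn K2 k (fun S v => ElS S (v J) (v e) n (v x) (v y)) :=
  all ((trans _).k2.imp ((mem _ _).imp ((mem _ _).imp (all ((eqFuns _ _ _).imp (all
    ((eqPow _ _).k2.imp (el n _ _ _ _ _ _ _).k2)))))))

lemma elS_iff {S : Z → Prop} (hS : K2 S) {J e : Z} (hJ : S J) (he : e ∈ J) (k : ℕ) {x y : Z}
    (hy : S y) (hyt : y.IsTransitive) (hxy : x ∈ y) :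
    ElS S J e k x y ↔ SEl (Nm J e) k (fun a => a ∈ x) (fun a => a ∈ y) := by
  constructor
  · intro h
    have hA : S (insert y y) := by
      obtain ⟨ν, hν, rfl⟩ := hS
      simp only [VC, rank_insert] at hy ⊢
      exact max_lt (hν _ hy) hy
    have hAt : (insert y y : Z).IsTransitive := by
      intro a ha
      rw [mem_insert_iff] at ha
      intro b hb
      rw [mem_insert_iff]
      rcases ha with rfl | ha
      · exact Or.inr hb
      · exact Or.inr (hyt a ha hb)
    have hy1 : y ∈ (insert y y : Z) := by simp
    have hx1 : x ∈ (insert y y : Z) := by simp [hxy]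
    exact (el_iff he hAt k hx1 hy1).1 (h _ hA (transE_iff.2 hAt) hx1 hy1 _ (hS.funs hJ hA) rfl _
      (hS.pow (hS.funs hJ hA)) rfl)
  · rintro h A hA hAt hx hy W hW rfl Q hQ rfl
    exact (el_iff he (transE_iff.1 hAt) k hx hy).2 h

end Paper

namespace Paper
open ZFSet Ordinal Cardinal
open scoped ZFSet

/-- internal definition of the class `C^(j)` -/
def Chi (S : Z → Prop) (J e : Z) : ℕ → Z → Prop
  | 0, α => OrdE zmem α
  | j+1, α => OrdE zmem α ∧ (∃ a, a ∈ α) ∧ ∀ β, S β → α ∈ β → Chi S J e j β →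
      ∀ x, S x → IsV x α → ∀ y, S y → IsV y β → ElS S J e (j+1) x y

lemma Dfn.chi (j : ℕ) : ∀ {k : ℕ} (J e α : Fin k),
    Dfn K2 k (fun S v => Chi S (v J) (v e) j (v α)) := by
  induction j with
  | zero => exact fun J e α => (ord α).k2
  | succ j ih =>
    intro k J e α
    have h1 : Dfn K2 k (fun S v => ∃ a, a ∈ v α) :=
      Dfn.congr (P := fun S v => ∃ a, S a ∧ a ∈ v α) (ex (mem _ _)) fun S hS v hv =>
        ⟨fun ⟨a, ha⟩ => ⟨a, hS.K1.1 _ (hv α) _ ha, ha⟩, fun ⟨a, _, ha⟩ => ⟨a, ha⟩⟩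
    exact (ord α).k2.and (h1.and (all ((mem _ _).imp ((ih _ _ _).imp (all ((isV _ _).k2.imp
      (all ((isV _ _).k2.imp (elS _ _ _ _ _)))))))))

/-- unboundedness of `C^(j)` -/
def Unb (S : Z → Prop) (J e : Z) (j : ℕ) : Prop :=
  ∀ a, S a → OrdE zmem a → ∃ β, S β ∧ (a ∈ β ∧ Chi S J e j β)

lemma Dfn.unb (j : ℕ) {k : ℕ} (J e : Fin k) : Dfn K2 k (fun S v => Unb S (v J) (v e) j) :=
  all ((ord _).k2.imp (ex ((mem _ _).and (chi _ _ _ _))))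

/-- all `C^(j)`, `j < m`, are unbounded -/
def UnbL (S : Z → Prop) (J e : Z) : ℕ → Prop
  | 0 => True
  | m+1 => UnbL S J e m ∧ Unb S J e m

lemma Dfn.unbL (j : ℕ) {k : ℕ} (J e : Fin k) : Dfn K2 k (fun S v => UnbL S (v J) (v e) j) := by
  induction j with
  | zero => exact Dfn.fal.not.congr fun _ _ _ _ => by simp [UnbL]
  | succ j ih => exact ih.and (unb _ _ _)

lemma unbL_iff {S : Z → Prop} {J e : Z} {m : ℕ} : UnbL S J e m ↔ ∀ j < m, Unb S J e j := by
  induction m with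
  | zero => simp [UnbL]
  | succ m ih =>
    simp only [UnbL, ih]
    constructor
    · rintro ⟨h1, h2⟩ j hj
      rcases Nat.lt_succ_iff_lt_or_eq.1 hj with h | rfl
      · exact h1 j h
      · exact h2
    · intro h
      exact ⟨fun j hj => h j (by omega), h m (by omega)⟩

section
variable {N : Type 1} [DecidableEq N]

lemma cn_sel [Infinite N] {j : ℕ} {α : Z} (hα : OrdE zmem α) (hne : 0 < α.rank) :
    CnE zmem j α ↔ SEl N j (VC α.rank) (fun _ => True) := by
  rw [cnE_iff, and_iff_right hα]
  exact sigmaElem_iff (VC_tc _) True_tc (fun _ _ => trivial) ⟨∅, by simpa [VC] using hne⟩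

lemma cn_pos {j : ℕ} {α : Z} (h : CnE zmem (j+1) α) : 0 < α.rank := by
  rw [cnE_iff] at h
  have h1 : IsSigma (j+1) (SetFormula.ex (.eq 0 0) : SetFormula 0) :=
    .ex (.ofDelta0 (.eq 0 0))
  have h2 := h.2.2 _ h1 ![] (fun i => i.elim0)
  rw [realizeIn_iff, realizeIn_iff, RI_ex, RI_ex] at h2
  obtain ⟨-, a, ha, -⟩ := h2.2 ⟨fun _ => trivial, ∅, trivial, rfl⟩
  exact zero_le.trans_lt ha

lemma down {j : ℕ} {ν : Ordinal.{0}} (hν : SEl N j (VC ν) (fun _ => True)) {P : Ordinal.{0} → Prop}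
    (hP : ∀ β, P β → SEl N j (VC β) (fun _ => True)) (hlim : ∀ o < ν, o + 1 < ν) {ρ}
    (hρ : Fam N (j+1) ρ) : ∀ γ₀ < ν, ∀ s : N → Z, (∀ i, VC γ₀ (s i)) → ρ (VC ν) s →
      ∃ γ < ν, ∀ β, γ ≤ β → P β → ρ (VC β) s := by
  generalize hk : j + 1 = k at hρ
  induction hρ with
  | @neg k ρ h1 _ =>
    obtain rfl : j = k := by omega
    intro γ₀ hγ₀ s hs h
    refine ⟨γ₀, hγ₀, fun β hβ hPβ h2 => h ?_⟩
    rw [hP β hPβ _ h1 s (fun i => (hs i).trans_le hβ)] at h2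
    exact (hν _ h1 s (fun i => (hs i).trans hγ₀)).2 h2
  | ex i _ ih =>
    rintro γ₀ hγ₀ s hs ⟨a, ha, h⟩
    obtain ⟨γ, hγ, h2⟩ := ih hk (max γ₀ (a.rank + 1)) (max_lt hγ₀ (hlim _ ha))
      (Function.update s i a) (by
        intro l
        by_cases hl : l = i
        · subst hl; simp [VC]
        · rw [Function.update_of_ne hl]; exact (hs l).trans_le (le_max_left _ _)) h
    refine ⟨max γ (a.rank + 1), max_lt hγ (hlim _ ha), fun β hβ hPβ => ⟨a, ?_, ?_⟩⟩
    · exact (lt_add_one _).trans_le ((le_max_right _ _).trans hβ)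
    · exact h2 β ((le_max_left _ _).trans hβ) hPβ
  | _ => omega

end

lemma memV (o : Ordinal.{0}) : (fun a : Z => a ∈ V_ o) = VC o := by
  funext x; simp [VC, mem_vonNeumann]

lemma sel_trans {N : Type 1} [DecidableEq N] {j : ℕ} {D T U : Z → Prop} (hDT : ∀ x, D x → T x)
    (h1 : SEl N j D U) (h2 : SEl N j T U) : SEl N j D T := fun ρ hρ s hs =>
  (h1 ρ hρ s hs).trans (h2 ρ hρ s (fun i => hDT _ (hs i))).symm

theorem chi_iff {ν : Ordinal.{0}} (hlim : ∀ o < ν, o + 1 < ν) {J e : Z} (hJ : VC ν J) (he : e ∈ J)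
    (hinf : InfJ J) {m : ℕ} (hν : SigmaElemPairE zmem m (VC ν) (fun _ => True))
    (hU : UnbL (VC ν) J e m) : ∀ j ≤ m, ∀ α, VC ν α → (Chi (VC ν) J e j α ↔ CnE zmem j α) := by
  have : Infinite (Nm J e) := Nm_infinite hinf
  have hK : K2 (VC ν) := ⟨ν, hlim, rfl⟩
  rw [unbL_iff] at hU
  have hνS : ∀ j ≤ m, SEl (Nm J e) j (VC ν) (fun _ => True) := fun j hj =>
    (sigmaElem_iff (VC_tc _) True_tc (fun _ _ => trivial) ⟨J, hJ⟩).1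
      ⟨fun _ _ => trivial, fun k φ hφ => hν.2 φ (hφ.mono hj)⟩
  intro j
  induction j with
  | zero => exact fun _ α _ => ⟨fun h => cnE_zero h, fun h => h.1⟩
  | succ j ih =>
    intro hj α hα
    have ih' := ih (by omega)
    constructor
    · rintro ⟨hO, ⟨a, ha⟩, h⟩
      have hpos : 0 < α.rank := zero_le.trans_lt (rank_lt_of_mem ha)
      have key : ∀ β : Z, VC ν β → α ∈ β → CnE zmem j β →
          SEl (Nm J e) (j+1) (VC α.rank) (VC β.rank) := by
        intro β hβ hαβ hc
        have := h β hβ hαβ ((ih' β hβ).2 hc) (V_ α.rank) (by simpa [VC] using hα)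
          (isV_iff.2 ⟨hO, rfl⟩) (V_ β.rank) (by simpa [VC] using hβ) (isV_iff.2 ⟨hc.1, rfl⟩)
        rwa [elS_iff hK hJ he (j+1) (by simpa [VC] using hβ) (isTransitive_vonNeumann _)
          (by simpa [mem_vonNeumann] using rank_lt_of_mem hαβ), memV, memV] at this
      rw [cn_sel (N := Nm J e) hO hpos]
      intro ρ hρ s hs
      constructor
      · intro h1
        obtain ⟨β, hβ, hαβ, hc⟩ := hU j (by omega) α hα hO
        rw [ih' β hβ] at hc
        have h2 := (key β hβ hαβ hc ρ hρ s hs).1 h1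
        have hr := rank_lt_of_mem hαβ
        exact fam_up (fun _ _ => trivial) ((cn_sel (N := Nm J e) hc.1 (hpos.trans hr)).1 hc) hρ s
          (fun i => (hs i).trans hr) h2
      · intro h1
        have h2 := (hνS (j+1) hj ρ hρ s (fun i => (hs i).trans hα)).2 h1
        obtain ⟨γ, hγ, h3⟩ := down (P := fun o => 0 < o ∧ CnE zmem j o.toZFSet) (hνS j (by omega))
          (fun o ho => by
            have := (cn_sel (N := Nm J e) ho.2.1 (by simpa using ho.1)).1 ho.2
            simpa using this) hlim hρ α.rank hα s hs h2
        obtain ⟨β, hβ, hαβ, hc⟩ := hU j (by omega) (max α.rank γ).toZFSet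
          (by simpa [VC] using ⟨hα, hγ⟩) (ordE_toZFSet _)
        rw [ih' β hβ] at hc
        have hr := rank_lt_of_mem hαβ
        rw [rank_toZFSet, max_lt_iff] at hr
        have h4 := h3 β.rank hr.2.le ⟨hpos.trans hr.1, by rw [ord_eq hc.1]; exact hc⟩
        exact (key β hβ ((ord_mem_iff hO hc.1).2 hr.1) hc ρ hρ s hs).2 h4
    · intro hC
      have hpos := cn_pos hC
      refine ⟨hC.1, ⟨∅, (ord_mem_iff (by simpa using ordE_toZFSet 0) hC.1).2 (by simpa using hpos)⟩, ?_⟩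
      intro β hβ hαβ hc x hx hxV y hy hyV
      rw [ih' β hβ] at hc
      obtain rfl := (isV_iff.1 hxV).2
      obtain rfl := (isV_iff.1 hyV).2
      have hr := rank_lt_of_mem hαβ
      rw [elS_iff hK hJ he (j+1) hy (isTransitive_vonNeumann _)
          (by simpa [mem_vonNeumann] using hr), memV, memV]
      have h1 := (cn_sel (N := Nm J e) hC.1 hpos).1 hC
      have h0 := (cn_sel (N := Nm J e) hC.1 hpos).1 (hC.mono (Nat.le_succ j))
      have hb := (cn_sel (N := Nm J e) hc.1 (hpos.trans hr)).1 hc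
      have hsub : ∀ x, VC α.rank x → VC β.rank x := fun x hx => lt_trans hx hr
      intro ρ hρ s hs
      constructor
      · exact fam_up hsub (sel_trans hsub h0 hb) hρ s hs
      · intro h
        exact (h1 ρ hρ s hs).2 (fam_up (fun _ _ => trivial) hb hρ s (fun i => hsub _ (hs i)) h)

/-- the final property -/
def Psi (m : ℕ) (φ : SetFormula 2) (S : Z → Prop) (z κ : Z) : Prop :=
  ∃ J, S J ∧ ∃ e, S e ∧ (e ∈ J ∧ (InfJ J ∧ (UnbL S J e m ∧ ∃ θ, S θ ∧ (CardE zmem θ ∧ (κ ∈ θ ∧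
    (Chi S J e m θ ∧ (HM θ z ∧ (HM θ κ ∧ RI (HM θ) φ ![z, κ]))))))))

lemma Dfn.infJ {k : ℕ} (J : Fin k) : Dfn K1 k (fun _ v => InfJ (v J)) := by
  have h1 : Dfn K1 k (fun S v => ∃ a, a ∈ v J) :=
    Dfn.congr (P := fun S v => ∃ a, S a ∧ a ∈ v J) (ex (mem _ _)) fun S hS v hv =>
      ⟨fun ⟨a, ha⟩ => ⟨a, hS.1 _ (hv J) _ ha, ha⟩, fun ⟨a, _, ha⟩ => ⟨a, ha⟩⟩
  exact h1.and (ball _ (bex _ (mem _ _)))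

lemma Dfn.psi (m : ℕ) (φ : SetFormula 2) : Dfn K2 2 (fun S v => Psi m φ S (v 0) (v 1)) := by
  have h : ∀ {k : ℕ} (i z κ : Fin k), Dfn K2 k (fun S v => RI (HM (v i)) φ ![v z, v κ]) := by
    intro k i z κ
    refine (Dfn.relH φ i ![z, κ]).congr fun S _ v _ => ?_
    have : (fun l => v (![z, κ] l)) = ![v z, v κ] := by
      funext l; fin_cases l <;> rfl
    rw [this]
  exact ex (ex ((mem _ _).and ((infJ _).k2.and ((unbL _ _ _).and (ex ((card _).and ((mem _ _).and
    ((chi _ _ _ _).and ((hm _ _).and ((hm _ _).and (h _ _ _)))))))))))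

end Paper

namespace Paper
open ZFSet Ordinal Cardinal
open scoped ZFSet

/-- least-effort witness bound -/
noncomputable def wit {n : ℕ} (φ : SetFormula (n+1)) (v : Fin n → Z) : Ordinal.{0} :=
  open Classical in
  if h : ∃ a, ¬ RI (fun _ => True) φ (Fin.snoc v a) then rank h.choose + 1 else 0

lemma wit_spec {n : ℕ} {φ : SetFormula (n+1)} {v : Fin n → Z}
    (h : ∃ a, ¬ RI (fun _ => True) φ (Fin.snoc v a)) :
    ∃ a, ¬ RI (fun _ => True) φ (Fin.snoc v a) ∧ rank a < wit φ v := by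
  refine ⟨h.choose, h.choose_spec, ?_⟩
  rw [wit, dif_pos h]
  exact lt_add_one _

/-- witness bound for all formulas with parameters of rank below `ξ` -/
noncomputable def witSup (ξ : Ordinal.{0}) : Ordinal.{0} :=
  ⨆ p : (Σ n : ℕ, SetFormula (n+1) × (Fin n → {y : Z // y ∈ V_ ξ})),
    wit p.2.1 (fun i => (p.2.2 i).1)

lemma le_witSup {ξ : Ordinal.{0}} {n : ℕ} (φ : SetFormula (n+1)) (v : Fin n → Z)
    (hv : ∀ i, VC ξ (v i)) : wit φ v ≤ witSup ξ := by
  have : Small.{0} {y : Z // y ∈ V_ ξ} := small_coe (V_ ξ)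
  exact Ordinal.le_iSup (fun p : (Σ n : ℕ, SetFormula (n+1) × (Fin n → {y : Z // y ∈ V_ ξ})) =>
    wit p.2.1 (fun i => (p.2.2 i).1)) ⟨n, φ, fun i => ⟨v i, mem_vonNeumann.2 (hv i)⟩⟩

/-- fully correct ordinals -/
def Corr (ν : Ordinal.{0}) : Prop := ∀ {n : ℕ} (φ : SetFormula n) (v : Fin n → Z),
  (∀ i, VC ν (v i)) → (RI (VC ν) φ v ↔ RI (fun _ => True) φ v)

theorem reflection (f : Ordinal.{0} → Ordinal.{0}) (a₀ : Ordinal.{0}) :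
    ∃ ν, a₀ < ν ∧ (∀ o < ν, o + 1 < ν) ∧ (∀ o < ν, ∃ o', o ≤ o' ∧ f o' < ν) ∧ Corr ν := by
  let F : Ordinal.{0} → Ordinal.{0} := fun ξ => max (ξ + 1) (max (f ξ) (witSup ξ))
  let x : ℕ → Ordinal.{0} := fun n => F^[n] a₀
  have hx : ∀ n, x (n+1) = F (x n) := fun n => Function.iterate_succ_apply' F n a₀
  have hlt : ∀ n, x n < x (n+1) := fun n => by
    rw [hx]; exact (lt_add_one _).trans_le (le_max_left _ _)
  have hmono : StrictMono x := strictMono_nat_of_lt_succ hlt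
  let ν : Ordinal.{0} := ⨆ n, x n
  have hle : ∀ n, x n ≤ ν := Ordinal.le_iSup x
  have hltν : ∀ n, x n < ν := fun n => (hlt n).trans_le (hle _)
  have hcof : ∀ o, o < ν → ∃ n, o < x n := fun o ho => Ordinal.lt_iSup_iff.1 ho
  refine ⟨ν, hltν 0, ?_, ?_, ?_⟩
  · intro o ho
    obtain ⟨n, hn⟩ := hcof o ho
    exact (Order.add_one_le_of_lt hn).trans_lt (hltν n)
  · intro o ho
    obtain ⟨n, hn⟩ := hcof o ho
    refine ⟨x n, hn.le, lt_of_le_of_lt ?_ (hltν (n+1))⟩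
    rw [hx]
    exact (le_max_left _ _).trans (le_max_right _ _)
  · intro n φ
    induction φ with
    | mem i j => exact fun v _ => Iff.rfl
    | eq i j => exact fun v _ => Iff.rfl
    | fal => exact fun v _ => Iff.rfl
    | imp φ ψ ih1 ih2 => intro v hv; simp only [RI, ih1 v hv, ih2 v hv]
    | @all n φ ih =>
      intro v hv
      simp only [RI]
      constructor
      · intro h
        by_contra hc
        obtain ⟨N, hN⟩ : ∃ N, ∀ i, VC (x N) (v i) := by
          choose g hg using fun i => hcof _ (hv i)
          refine ⟨Finset.univ.sup g, fun i => (hg i).trans_le (hmono.monotone ?_)⟩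
          exact Finset.le_sup (f := g) (Finset.mem_univ i)
        obtain ⟨a, ha, hr⟩ := wit_spec (φ := φ) (v := v) (by
          by_contra hc'
          push Not at hc'
          exact hc fun a _ => hc' a)
        have haν : VC ν a := by
          refine (hr.trans_le (le_witSup φ v hN)).trans_le (le_trans ?_ (hle (N+1)))
          rw [hx]
          exact (le_max_right _ _).trans (le_max_right _ _)
        exact ha ((ih _ (snoc_mem hv haν)).1 (h a haν))
      · intro h a ha
        exact (ih _ (snoc_mem hv ha)).2 (h a trivial)

lemma Corr.sigma {ν : Ordinal.{0}} (h : Corr ν) (m : ℕ) :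
    SigmaElemPairE zmem m (VC ν) (fun _ => True) := by
  refine ⟨fun _ _ => trivial, fun k φ _ v hv => ?_⟩
  rw [realizeIn_iff, realizeIn_iff, h φ v hv]
  simp [hv]

lemma Corr.cn {ν : Ordinal.{0}} (h : Corr ν) (m : ℕ) : CnE zmem m ν.toZFSet := by
  rw [cnE_iff, rank_toZFSet]
  exact ⟨ordE_toZFSet _, h.sigma m⟩

theorem exists_good (a₀ : Ordinal.{0}) : ∃ ν : Ordinal.{0}, a₀ < ν ∧ (∀ o < ν, o + 1 < ν) ∧ Corr ν ∧
    (∀ o < ν, ∃ β < ν, o < β ∧ Corr β) ∧ CardE zmem ν.toZFSet ∧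
    (fun x => HMemE zmem x ν.toZFSet) = VC ν := by
  have h1 : ∀ ξ : Ordinal.{0}, ∃ β, ξ < β ∧ Corr β := fun ξ => by
    obtain ⟨β, h, -, -, h2⟩ := reflection id ξ
    exact ⟨β, h, h2⟩
  choose c hc hcc using h1
  obtain ⟨ν, h0, hlim, hf, hC⟩ := reflection
    (fun ξ => max (c ξ) (Order.succ (ZFSet.card (V_ ξ))).ord) a₀
  have hcard : ∀ o < ν, ZFSet.card (V_ o) < ν.card := by
    intro o ho
    obtain ⟨o', h1, h2⟩ := hf o ho
    have h3 := (Cardinal.ord_le.1 ((le_max_right _ _).trans h2.le))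
    refine lt_of_le_of_lt (card_mono ?_) (Order.succ_le_iff.1 h3)
    intro y hy
    rw [mem_vonNeumann] at hy ⊢
    exact hy.trans_le h1
  have hν : CardE zmem ν.toZFSet := by
    rw [cardE_iff, rank_toZFSet]
    refine ⟨ordE_toZFSet _, le_antisymm (Cardinal.ord_card_le _) (le_of_not_gt fun h => ?_)⟩
    have h2 := hcard _ h
    have h3 := rank_card_of_trans (isTransitive_vonNeumann ν.card.ord)
    rw [rank_vonNeumann, card_ord] at h3
    exact absurd h2 (not_lt.2 h3)
  refine ⟨ν, h0, hlim, hC, ?_, hν, ?_⟩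
  · intro o ho
    obtain ⟨o', h1, h2⟩ := hf o ho
    exact ⟨c o', (le_max_left _ _).trans_lt h2, h1.trans_lt (hc o'), hcc o'⟩
  · funext x
    refine propext ⟨fun h => by simpa [VC] using hmem_rank hν h, fun h => ?_⟩
    refine (hmem_iff hν).2 ⟨V_ x.rank, isTransitive_vonNeumann _, subset_vonNeumann.2 le_rfl, ?_⟩
    rw [rank_toZFSet]
    exact hcard _ h

lemma HM_eq {θ : Z} (h : CardE zmem θ) : HM θ = fun x => HMemE zmem x θ := by
  funext x; simp [HM, h]

theorem shrewd_mono {m n : ℕ} (hmn : m < n) {κ : Z} (h : CnWeaklyShrewdE zmem n κ) :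
    CnWeaklyShrewdE zmem m κ := by
  refine ⟨h.1, fun φ θ z hθ hθC hκθ hz hr => ?_⟩
  obtain ⟨hr1, hr2⟩ := realizeIn_iff.1 hr
  obtain ⟨ν, h0, hlim, hC, hunb, hν, hH⟩ := exists_good (max θ.rank (ω + 1))
  rw [max_lt_iff] at h0
  have hθν : VC ν θ := h0.1
  have hκν : VC ν κ := (rank_lt_of_mem hκθ).trans hθν
  have hzν : VC ν z := (rank_mono (subE_iff.1 hz)).trans_lt hκν
  have hK : K2 (VC ν) := ⟨ν, hlim, rfl⟩
  let J : Z := (ω : Ordinal.{0}).toZFSet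
  let e : Z := (0 : Ordinal.{0}).toZFSet
  have hJ : VC ν J := by simpa [VC, J] using (lt_add_one _).trans h0.2
  have he : e ∈ J := by
    rw [ord_mem_iff (ordE_toZFSet _) (ordE_toZFSet _), rank_toZFSet, rank_toZFSet]
    exact omega0_pos
  have hinf : InfJ J := by
    refine ⟨⟨e, he⟩, fun a ha => ?_⟩
    have ha' := (ord_mem_iff' (ordE_toZFSet _)).1 ha
    refine ⟨(a.rank + 1).toZFSet, (ord_mem_iff (ordE_toZFSet _) (ordE_toZFSet _)).2 ?_,
      (ord_mem_iff ha'.1 (ordE_toZFSet _)).2 ?_⟩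
    · have h2 := ha'.2
      rw [rank_toZFSet] at h2 ⊢
      rw [rank_toZFSet]
      exact isSuccLimit_omega0.add_one_lt h2
    · rw [rank_toZFSet]; exact lt_add_one _
  have hU : ∀ k, UnbL (VC ν) J e k := by
    intro k
    induction k with
    | zero => trivial
    | succ k ih =>
      refine ⟨ih, fun a ha hao => ?_⟩
      obtain ⟨β, hβ, hoβ, hβC⟩ := hunb _ ha
      have hβ' : VC ν β.toZFSet := by simpa [VC] using hβ
      exact ⟨β.toZFSet, hβ', (ord_mem_iff hao (ordE_toZFSet _)).2 (by simpa using hoβ),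
        (chi_iff hlim hJ he hinf (hC.sigma k) ih k le_rfl _ hβ').2 (hβC.cn k)⟩
  have hPsi : Psi m φ (VC ν) z κ := by
    refine ⟨J, hJ, e, (VC_tc ν) _ hJ _ he, he, hinf, hU m, θ, hθν, hθ, hκθ,
      (chi_iff hlim hJ he hinf (hC.sigma m) (hU m) m le_rfl _ hθν).2 hθC,
      ⟨hθ, hr1 0⟩, ⟨hθ, hr1 1⟩, ?_⟩
    rw [HM_eq hθ]
    exact hr2
  have hTheta : Theta (VC ν) := by
    refine ⟨fun α hα hαo => ⟨V_ α.rank, by simpa [VC] using hα, isV_iff.2 ⟨hαo, rfl⟩⟩, fun a ha =>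
      ⟨{a}, ?_, by simp⟩⟩
    simpa [VC] using hlim _ ha
  obtain ⟨ψ, hψ⟩ := Dfn.psi m φ
  obtain ⟨τ, hτ⟩ := Dfn.theta (k := 2)
  have hv : ∀ i, VC ν ((![z, κ] : Fin 2 → Z) i) := by
    intro i; fin_cases i
    · exact hzν
    · exact hκν
  obtain ⟨κ', ν', z', hκ', hν', hν'C, hκν', hκκ', hz', hr'⟩ :=
    h.2 (τ.and ψ) ν.toZFSet z hν (hC.cn n)
      ((ord_mem_iff h.1.1 (ordE_toZFSet _)).2 (by simpa [VC] using hκν)) hz (by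
        rw [hH, realizeIn_iff, RI_and]
        exact ⟨hv, (hτ _ hK.K1 _ hv).2 hTheta, (hψ _ hK _ hv).2 hPsi⟩)
  rw [realizeIn_iff, RI_and] at hr'
  obtain ⟨hv', ht', hp'⟩ := hr'
  obtain ⟨hE, hlim'⟩ := theta_H hν' ((hτ _ (hmem_K1 ν') _ hv').1 ht')
  rw [hE] at hp'
  replace hv' : ∀ i, VC ν'.rank ((![z', κ'] : Fin 2 → Z) i) := fun i => hmem_rank hν' (hv' i)
  obtain ⟨J', hJ', e', -, he', hinf', hU', θ', hθν', hθ', hκθ', hchi, hz2, hκ2, hr2'⟩ :=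
    (hψ _ ⟨_, hlim', rfl⟩ _ hv').1 hp'
  refine ⟨κ', θ', z', hκ', hθ', ?_, hκθ', hκκ', hz', ?_⟩
  · exact (chi_iff hlim' hJ' he' hinf' (cnE_iff.1 (hν'C.mono hmn.le)).2 hU' m le_rfl _ hθν').1 hchi
  · rw [realizeIn_iff, ← HM_eq hθ']
    refine ⟨fun i => ?_, hr2'⟩
    fin_cases i
    · exact hz2.2
    · exact hκ2.2

end Paper

namespace Paper

/-- **Proposition 3.2.**
(1) Given natural numbers `m < n`, every `C⁽ⁿ⁾`-weakly shrewd cardinal is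
    `C⁽ᵐ⁾`-weakly shrewd.
(2) A cardinal is weakly shrewd if and only if it is `C⁽ⁿ⁾`-weakly shrewd for some
    natural number `n < 2`. -/
theorem cnWeaklyShrewd_mono_and_weaklyShrewd_iff :
    (∀ m n : ℕ, m < n → ∀ κ : ZFSet.{0},
      CnWeaklyShrewdE zmem n κ → CnWeaklyShrewdE zmem m κ) ∧
    ∀ κ : ZFSet.{0}, WeaklyShrewdE zmem κ ↔
      ∃ n : ℕ, n < 2 ∧ CnWeaklyShrewdE zmem n κ := by
  refine ⟨fun m n hmn κ h => shrewd_mono hmn h, fun κ => ?_⟩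
  rw [ws_iff_zero]
  constructor
  · exact fun h => ⟨0, by omega, h⟩
  · rintro ⟨n, hn, h⟩
    rcases Nat.eq_zero_or_pos n with rfl | hpos
    · exact h
    · exact shrewd_mono hpos h

end Paper
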